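/- Let D be a domain in ℂⁿ, let a₁,…,a_m : D → ℂ be continuous, write P(z,w) = wᵐ + a₁(z)w^{m−1} + ⋯ + a_m(z), and let B = {z ∈ D : P(z,·) has a root of multiplicity m}. Assume a₁,…,a_m are holomorphic on D ∖ B and that B is not pluripolar in ℂⁿ. Then P(z,w) = (w + a₁(z)/m)ᵐ for all (z,w) ∈ D × ℂ; in particular B = D and a_ℓ(z) = C(m,ℓ)·(a₁(z)/m)^ℓ for every ℓ = 1,…,m and z ∈ D. -/

import Mathlib

open Metric Set Polynomial

noncomputable section

/-- A function `u : ℂ → EReal` is subharmonic on an open set `U` if it is upper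
semicontinuous on `U` and satisfies the maximum principle with respect to harmonic
majorants of the form `Re p`, `p` a complex polynomial, on every closed disc in `U`. -/
def SubharmonicOn (u : ℂ → EReal) (U : Set ℂ) : Prop :=
  UpperSemicontinuousOn u U ∧
    ∀ (c : ℂ) (r : ℝ), 0 < r → closedBall c r ⊆ U →
      ∀ p : Polynomial ℂ,
        (∀ z ∈ sphere c r, u z ≤ (((p.eval z).re : ℝ) : EReal)) →
        ∀ z ∈ closedBall c r, u z ≤ (((p.eval z).re : ℝ) : EReal)

/-- `u : ℂ^N → [-∞, ∞)` is plurisubharmonic if it is upper semicontinuous, takes values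
in `[-∞, ∞)`, and its restriction to every complex affine line is subharmonic. -/
def Plurisubharmonic {N : ℕ} (u : (Fin N → ℂ) → EReal) : Prop :=
  UpperSemicontinuous u ∧ (∀ z, u z ≠ ⊤) ∧
    ∀ a b : Fin N → ℂ, SubharmonicOn (fun t : ℂ => u (a + t • b)) Set.univ

/-- A set `E ⊆ ℂ^N` is pluripolar if there is a plurisubharmonic function on `ℂ^N`,
not identically `-∞`, which is `-∞` on `E`. -/
def Pluripolar {N : ℕ} (E : Set (Fin N → ℂ)) : Prop :=
  ∃ u : (Fin N → ℂ) → EReal,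
    Plurisubharmonic u ∧ ¬ (∀ z, u z = ⊥) ∧ ∀ z ∈ E, u z = ⊥


lemma rado_max {f g : ℂ → ℂ} {R M : ℝ}
    (hf : ContinuousOn f (closedBall 0 R)) (hg : ContinuousOn g (closedBall 0 R))
    (hfd : ∀ z ∈ ball (0:ℂ) R, f z ≠ 0 → DifferentiableAt ℂ f z)
    (hgd : ∀ z ∈ ball (0:ℂ) R, f z ≠ 0 → DifferentiableAt ℂ g z)
    (hM0 : 0 ≤ M) (hM : ∀ z ∈ sphere (0:ℂ) R, ‖g z‖ ≤ M) :
    ∀ z ∈ ball (0:ℂ) R, f z ≠ 0 → ‖g z‖ ≤ M := by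
  intro z hz hfz
  obtain ⟨A, hA⟩ := (isCompact_closedBall (0:ℂ) R).exists_bound_of_continuousOn hf
  have hA0 : 0 ≤ A := (norm_nonneg _).trans (hA z (ball_subset_closedBall hz))
  set U : Set ℂ := ball 0 R ∩ {w | f w ≠ 0} with hU
  have hUc : closure U ⊆ closedBall 0 R :=
    (closure_mono inter_subset_left).trans closure_ball_subset_closedBall
  have hUo : IsOpen U := by
    have := (hf.mono ball_subset_closedBall).isOpen_inter_preimage isOpen_ball
      (isOpen_compl_singleton (x := (0:ℂ)))
    exact this
  have key : ∀ N : ℕ, ‖f z‖ * ‖g z‖ ^ N ≤ A * M ^ N := by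
    intro N
    have hd : DiffContOnCl ℂ (fun w => f w * g w ^ N) U := by
      constructor
      · intro w hw
        exact ((hfd w hw.1 hw.2).mul ((hgd w hw.1 hw.2).pow N)).differentiableWithinAt
      · exact (hf.mul (hg.pow N)).mono hUc
    have := Complex.norm_le_of_forall_mem_frontier_norm_le (isBounded_ball.subset inter_subset_left)
      hd (C := A * M ^ N) ?_ (subset_closure (⟨hz, hfz⟩ : z ∈ U))
    · simpa using this
    · intro w hw
      have hwc := hUc hw.1
      have hw2 : w ∉ U := by
        have h3 := hw.2
        rwa [← hU, hUo.interior_eq] at h3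
      by_cases hws : w ∈ sphere (0:ℂ) R
      · rw [norm_mul, norm_pow]
        gcongr
        · exact hA w hwc
        · exact hM w hws
      · have : w ∈ ball (0:ℂ) R := by
          rw [mem_ball]; exact lt_of_le_of_ne hwc hws
        have : f w = 0 := by
          by_contra h
          exact hw2 ⟨this, h⟩
        simp [this]
        positivity
  by_contra hlt
  push Not at hlt
  have hgz : 0 < ‖g z‖ := lt_of_le_of_lt hM0 hlt
  have ht : Filter.Tendsto (fun N : ℕ => A * (M / ‖g z‖) ^ N) Filter.atTop (nhds (A * 0)) :=
    (tendsto_pow_atTop_nhds_zero_of_lt_one (by positivity) ((div_lt_one hgz).2 hlt)).const_mul A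
  have : ‖f z‖ ≤ A * 0 := by
    refine ge_of_tendsto' ht fun N => ?_
    rw [div_pow, ← mul_div_assoc, le_div_iff₀ (by positivity)]
    exact key N
  simp at this
  exact hfz this

lemma exists_poly_re_approx {u : ℂ → ℝ} {R : ℝ} (hR : 0 < R) (hu : ContinuousOn u (sphere 0 R))
    {ε : ℝ} (hε : 0 < ε) : ∃ p : ℂ[X], ∀ z ∈ sphere (0:ℂ) R, |u z - (p.eval z).re| < ε := by
  have : Fact ((0:ℝ) < 1) := ⟨one_pos⟩
  let φ : AddCircle (1:ℝ) → ℂ := fun t => R * (AddCircle.toCircle t : ℂ)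
  have hφ : Continuous φ := by
    have : Continuous (fun t : AddCircle (1:ℝ) => (AddCircle.toCircle t : ℂ)) :=
      continuous_subtype_val.comp AddCircle.continuous_toCircle
    exact continuous_const.mul this
  have hφs : ∀ t, φ t ∈ sphere (0:ℂ) R := by
    intro t
    have := Circle.norm_coe (AddCircle.toCircle t)
    simp only [φ, mem_sphere_iff_norm, sub_zero, norm_mul, this]
    simp [abs_of_pos hR]
  let v : C(AddCircle (1:ℝ), ℂ) := ⟨fun t => (u (φ t) : ℂ),
    Complex.continuous_ofReal.comp (hu.comp_continuous hφ hφs)⟩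
  have hv : v ∈ (Submodule.span ℂ (range (@fourier 1))).topologicalClosure := by
    rw [span_fourier_closure_eq_top]; trivial
  rw [← SetLike.mem_coe, Submodule.topologicalClosure_coe, Metric.mem_closure_iff] at hv
  obtain ⟨g, hg, hgv⟩ := hv ε hε
  have hQ : ∃ A C : ℂ[X], ∀ t, g t = A.eval (φ t) + starRingEnd ℂ (C.eval (φ t)) := by
    refine Submodule.span_induction (p := fun (g : C(AddCircle (1:ℝ), ℂ)) _ =>
      ∃ A C : ℂ[X], ∀ t, g t = A.eval (φ t) + starRingEnd ℂ (C.eval (φ t))) ?_ ?_ ?_ ?_ hg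
    · rintro _ ⟨n, rfl⟩
      obtain ⟨k, rfl | rfl⟩ := n.eq_nat_or_neg
      · refine ⟨Polynomial.C ((R:ℂ)⁻¹ ^ k) * X ^ k, 0, fun t => ?_⟩
        have : (R:ℂ) ≠ 0 := by exact_mod_cast hR.ne'
        simp [φ, fourier_apply, AddCircle.toCircle_nsmul]
        field_simp
        rw [mul_pow]; ring
      · refine ⟨0, Polynomial.C ((R:ℂ)⁻¹ ^ k) * X ^ k, fun t => ?_⟩
        have : (R:ℂ) ≠ 0 := by exact_mod_cast hR.ne'
        rw [fourier_neg]
        simp [φ, fourier_apply, AddCircle.toCircle_nsmul]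
        field_simp
        rw [mul_pow]; ring
    · exact ⟨0, 0, by simp⟩
    · rintro x y _ _ ⟨A, C, h⟩ ⟨A', C', h'⟩
      refine ⟨A + A', C + C', fun t => ?_⟩
      simp [h, h']; ring
    · rintro a x _ ⟨A, C, h⟩
      refine ⟨Polynomial.C a * A, Polynomial.C (starRingEnd ℂ a) * C, fun t => ?_⟩
      simp [h]; ring
  obtain ⟨A, C, h⟩ := hQ
  refine ⟨A + C, fun z hz => ?_⟩
  have hz' : ‖z‖ = R := by simpa using hz
  obtain ⟨t, ht⟩ := (AddCircle.homeomorphCircle (T := 1) one_ne_zero).surjective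
    (⟨z / R, by simp [Submonoid.unitSphere, hz', abs_of_pos hR, hR.ne']⟩ : Circle)
  rw [AddCircle.homeomorphCircle_apply] at ht
  have htz : φ t = z := by
    have h0 : (R:ℂ) ≠ 0 := by exact_mod_cast hR.ne'
    simp only [φ, ht]
    field_simp
  have h1 : ‖v t - g t‖ < ε := by
    have := ContinuousMap.dist_lt_iff hε |>.1 hgv t
    rwa [dist_eq_norm] at this
  have h2 := (Complex.abs_re_le_norm _).trans_lt h1
  simp only [v, ContinuousMap.coe_mk, h, htz] at h2
  simpa using h2


lemma deriv_zero_of_re_zero {h : ℂ → ℂ} {d z : ℂ} (hd : HasDerivAt h d z)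
    (hz : ∀ᶠ w in nhds z, (h w).re = 0) : d = 0 := by
  have h1 := Complex.reCLM.hasFDerivAt.comp z (hd.hasFDerivAt.restrictScalars ℝ)
  have h2 : HasFDerivAt (Complex.reCLM ∘ h) (0 : ℂ →L[ℝ] ℝ) z := by
    refine (hasFDerivAt_const (0:ℝ) z).congr_of_eventuallyEq ?_
    filter_upwards [hz] with w hw
    simpa using hw
  have h3 := h1.unique h2
  have e1 := congrArg (fun L => L 1) h3
  have e2 := congrArg (fun L => L Complex.I) h3
  simp at e1 e2
  exact Complex.ext e1 e2

lemma rado_re {f : ℂ → ℂ} {R : ℝ} (hR : 0 < R)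
    (hf : ContinuousOn f (closedBall 0 R))
    (hfd : ∀ z ∈ ball (0:ℂ) R, f z ≠ 0 → DifferentiableAt ℂ f z) :
    ∃ F : ℂ → ℂ, DifferentiableOn ℂ F (ball 0 R) ∧
      ∀ z ∈ ball (0:ℂ) R, f z ≠ 0 → (F z).re = (f z).re := by
  have hfs : ContinuousOn f (sphere 0 R) := hf.mono sphere_subset_closedBall
  have hu : ContinuousOn (fun z => (f z).re) (sphere 0 R) :=
    Complex.continuous_re.comp_continuousOn hfs
  have hci : CircleIntegrable (fun z => (f z).re) 0 R := hu.circleIntegrable hR.le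
  have hci2 : CircleIntegrable (fun z => ((f z).re : ℂ)) 0 R :=
    (Complex.continuous_ofReal.comp_continuousOn hu).circleIntegrable hR.le
  refine ⟨fun w => Real.circleAverage
    (fun ζ ↦ herglotzRieszKernel 0 w ζ • ((f ζ).re : ℂ)) 0 R,
    differentiableOn_circleAverage_herglotzRieszKernel_smul hci2, ?_⟩
  intro z hz hfz
  rw [re_circleAverage_herglotzRieszKernel_smul hci hz]
  have hk : ContinuousOn (Complex.re ∘ herglotzRieszKernel 0 z) (sphere 0 |R|) :=
    Complex.continuous_re.comp_continuousOn (continuousOn_herglotzRieszKernel_sphere hz)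
  rw [abs_of_pos hR] at hk
  have hkpos : ∀ ζ ∈ sphere (0:ℂ) R, 0 ≤ (Complex.re ∘ herglotzRieszKernel 0 z) ζ := by
    intro ζ hζ
    refine le_trans ?_ (le_re_herglotzRieszKernel hζ hz)
    have : ‖z - 0‖ < R := by simpa using hz
    exact div_nonneg (by linarith) (by positivity)
  have hpoly : ∀ p : ℂ[X], (p.eval z).re =
      Real.circleAverage ((Complex.re ∘ herglotzRieszKernel 0 z) • (fun ζ => (p.eval ζ).re)) 0 R := by
    intro p
    have h1 := DiffContOnCl.circleAverage_re_herglotzRieszKernel_smul (f := fun ζ => p.eval ζ)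
      (p.differentiable.diffContOnCl (s := ball 0 R)) hz
    rw [← h1]
    have := Complex.reCLM.circleAverage_comp_comm (c := 0) (R := R)
      (f := (Complex.re ∘ herglotzRieszKernel 0 z) • (fun ζ => p.eval ζ)) ?_
    · simp only [Complex.reCLM_apply] at this
      rw [← this]
      congr 1
      ext ζ
      simp
    · exact (hk.smul p.continuous.continuousOn).circleIntegrable hR.le
  have hcp : ∀ p : ℂ[X], CircleIntegrable
      ((Complex.re ∘ herglotzRieszKernel 0 z) • (fun ζ => (p.eval ζ).re)) 0 R := fun p =>
    (hk.smul (Complex.continuous_re.comp p.continuous).continuousOn).circleIntegrable hR.le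
  have hcf : CircleIntegrable
      ((Complex.re ∘ herglotzRieszKernel 0 z) • (fun ζ => (f ζ).re)) 0 R :=
    (hk.smul hu).circleIntegrable hR.le
  have hexp : ∀ (s : ℂ) (p : ℂ[X]), (∀ ζ ∈ sphere (0:ℂ) R, (s * f ζ - p.eval ζ).re ≤ 0) →
      (s * f z - p.eval z).re ≤ 0 := by
    intro s p h
    have := rado_max (M := 1) (g := fun ζ => Complex.exp (s * f ζ - p.eval ζ)) hf
      (Complex.continuous_exp.comp_continuousOn
        ((continuousOn_const.mul hf).sub p.continuous.continuousOn)) hfd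
      (fun w hw hfw => (((hfd w hw hfw).const_mul s).sub p.differentiable.differentiableAt).cexp)
      zero_le_one ?_ z hz hfz
    · rwa [Complex.norm_exp, Real.exp_le_one_iff] at this
    · intro w hw
      rw [Complex.norm_exp, Real.exp_le_one_iff]
      exact h w hw
  apply eq_of_forall_dist_le
  intro ε hε
  obtain ⟨p, hp⟩ := exists_poly_re_approx hR hu (half_pos hε)
  have a1 : (f z).re ≤ (p.eval z).re + ε / 2 := by
    have := hexp 1 (p + Polynomial.C ((ε/2 : ℝ):ℂ)) ?_
    · simp at this
      linarith
    · intro ζ hζ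
      have := abs_lt.1 (hp ζ hζ)
      simp
      linarith
  have a2 : (p.eval z).re - ε / 2 ≤ (f z).re := by
    have := hexp (-1) (-p + Polynomial.C ((ε/2 : ℝ):ℂ)) ?_
    · simp at this
      linarith
    · intro ζ hζ
      have := abs_lt.1 (hp ζ hζ)
      simp
      linarith
  have a3 : Real.circleAverage ((Complex.re ∘ herglotzRieszKernel 0 z) • (fun ζ => (f ζ).re)) 0 R
      ≤ (p.eval z).re + ε / 2 := by
    have h1 := hpoly (p + Polynomial.C ((ε/2 : ℝ):ℂ))
    have h2 : ((p + Polynomial.C ((ε/2 : ℝ):ℂ)).eval z).re = (p.eval z).re + ε / 2 := by simp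
    rw [← h2, h1]
    refine Real.circleAverage_mono hcf (hcp _) ?_
    intro ζ hζ
    rw [abs_of_pos hR] at hζ
    have := abs_lt.1 (hp ζ hζ)
    refine mul_le_mul_of_nonneg_left ?_ (hkpos ζ hζ)
    simp
    linarith
  have a4 : (p.eval z).re - ε / 2 ≤
      Real.circleAverage ((Complex.re ∘ herglotzRieszKernel 0 z) • (fun ζ => (f ζ).re)) 0 R := by
    have h1 := hpoly (p - Polynomial.C ((ε/2 : ℝ):ℂ))
    have h2 : ((p - Polynomial.C ((ε/2 : ℝ):ℂ)).eval z).re = (p.eval z).re - ε / 2 := by simp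
    rw [← h2, h1]
    refine Real.circleAverage_mono (hcp _) hcf ?_
    intro ζ hζ
    rw [abs_of_pos hR] at hζ
    have := abs_lt.1 (hp ζ hζ)
    refine mul_le_mul_of_nonneg_left ?_ (hkpos ζ hζ)
    simp
    linarith
  rw [Real.dist_eq, abs_le]
  constructor <;> linarith

lemma isPreconnected_punctured_ball (z : ℂ) {δ : ℝ} (hδ : 0 < δ) :
    IsPreconnected (ball z δ \ {z}) := by
  have h1 : IsPreconnected {w : ℂ | w.re < Real.log δ} :=
    (convex_halfSpace_re_lt _).isPreconnected
  have h2 := h1.image (fun w => z + Complex.exp w) (by fun_prop)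
  convert h2 using 1
  ext w
  simp only [mem_sdiff, mem_ball, dist_eq_norm, mem_singleton_iff, mem_image, mem_ofPred_eq]
  constructor
  · rintro ⟨h, hne⟩
    have h0 : w - z ≠ 0 := sub_ne_zero.2 hne
    refine ⟨Complex.log (w - z), ?_, ?_⟩
    · rw [Complex.log_re]
      exact Real.log_lt_log (norm_pos_iff.2 h0) h
    · rw [Complex.exp_log h0]; ring
  · rintro ⟨v, hv, rfl⟩
    refine ⟨?_, ?_⟩
    · rw [add_sub_cancel_left, Complex.norm_exp]
      rwa [← Real.lt_log_iff_exp_lt hδ]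
    · simp [Complex.exp_ne_zero]

theorem rado {f : ℂ → ℂ} {R : ℝ} (hR : 0 < R)
    (hf : ContinuousOn f (closedBall 0 R))
    (hfd : ∀ z ∈ ball (0:ℂ) R, f z ≠ 0 → DifferentiableAt ℂ f z) :
    DifferentiableOn ℂ f (ball 0 R) := by
  by_cases hne : ∃ z0 ∈ ball (0:ℂ) R, f z0 ≠ 0
  swap
  · push Not at hne
    exact (differentiableOn_const (0:ℂ)).congr hne
  obtain ⟨z0, hz0, hfz0⟩ := hne
  have hfb : ContinuousOn f (ball 0 R) := hf.mono ball_subset_closedBall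
  have hcat : ∀ z ∈ ball (0:ℂ) R, ContinuousAt f z := fun z hz =>
    hfb.continuousAt (isOpen_ball.mem_nhds hz)
  obtain ⟨F, hF, hFre⟩ := rado_re hR hf hfd
  obtain ⟨G, hG, hGre⟩ := rado_re (f := fun z => Complex.I * f z) hR (continuousOn_const.mul hf)
    (fun z hz h => (hfd z hz (right_ne_zero_of_mul h)).const_mul _)
  have hnear : ∀ z ∈ ball (0:ℂ) R, f z ≠ 0 → ∀ᶠ w in nhds z, w ∈ ball (0:ℂ) R ∧ f w ≠ 0 :=
    fun z hz h => Filter.Eventually.and (isOpen_ball.mem_nhds hz) ((hcat z hz).eventually_ne h)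
  have hFd : ∀ z ∈ ball (0:ℂ) R, DifferentiableAt ℂ F z := fun z hz =>
    hF.differentiableAt (isOpen_ball.mem_nhds hz)
  have hGd : ∀ z ∈ ball (0:ℂ) R, DifferentiableAt ℂ G z := fun z hz =>
    hG.differentiableAt (isOpen_ball.mem_nhds hz)
  set K : ℂ → ℂ := fun z => G z - Complex.I * F z with hK
  have hKd : DifferentiableOn ℂ K (ball 0 R) := hG.sub (hF.const_mul _)
  -- on the set where f ≠ 0, f = F - I * Re K
  have hfK : ∀ z ∈ ball (0:ℂ) R, f z ≠ 0 → f z = F z - Complex.I * ((K z).re : ℂ) := by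
    intro z hz h
    have e1 := hFre z hz h
    have e2 := hGre z hz (mul_ne_zero Complex.I_ne_zero h)
    apply Complex.ext
    · simp [e1]
    · simp at e2
      simp [hK, e2]
  have hK0 : ∀ z ∈ ball (0:ℂ) R, f z ≠ 0 → deriv K z = 0 := by
    intro z hz h
    have hKz : DifferentiableAt ℂ K z := hKd.differentiableAt (isOpen_ball.mem_nhds hz)
    have d1 := ((hfd z hz h).sub (hFd z hz)).hasDerivAt
    have d2 := deriv_zero_of_re_zero d1 (by
      filter_upwards [hnear z hz h] with w hw
      have := hFre w hw.1 hw.2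
      simp [this])
    rw [d2] at d1
    have d3 := hKz.hasDerivAt.sub (d1.const_mul Complex.I)
    have d4 := deriv_zero_of_re_zero d3 (by
      filter_upwards [hnear z hz h] with w hw
      have := hfK w hw.1 hw.2
      simp [this])
    simpa using d4
  have hKc : ∀ z ∈ ball (0:ℂ) R, K z = K z0 := by
    have hev : K =ᶠ[nhds z0] fun _ => K z0 := by
      obtain ⟨δ, hδ, hsub⟩ := Metric.eventually_nhds_iff_ball.1 (hnear z0 hz0 hfz0)
      filter_upwards [ball_mem_nhds z0 hδ] with w hw
      refine isOpen_ball.is_const_of_deriv_eq_zero (s := ball z0 δ)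
        (convex_ball _ _).isPreconnected (hKd.mono fun x hx => (hsub x hx).1)
        (fun x hx => hK0 x (hsub x hx).1 (hsub x hx).2) hw (mem_ball_self hδ)
    exact (hKd.analyticOnNhd isOpen_ball).eqOn_of_preconnected_of_eventuallyEq
      analyticOnNhd_const (convex_ball _ _).isPreconnected hz0 hev
  set H : ℂ → ℂ := fun z => F z - Complex.I * ((K z0).re : ℂ) with hH
  have hHd : DifferentiableOn ℂ H (ball 0 R) := hF.sub_const _
  have hHa := hHd.analyticOnNhd isOpen_ball
  have hHf : ∀ z ∈ ball (0:ℂ) R, f z ≠ 0 → f z = H z := by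
    intro z hz h
    rw [hfK z hz h, hKc z hz]
  have hHc : ∀ z ∈ ball (0:ℂ) R, ContinuousAt H z := fun z hz => (hHa z hz).continuousAt
  suffices h : ball (0:ℂ) R ⊆ {z | ∀ᶠ w in nhds z, f w = H w} from
    hHd.congr fun z hz => (h hz).self_of_nhds
  refine (convex_ball (0:ℂ) R).isPreconnected.subset_of_closure_inter_subset
    isOpen_setOfPred_eventually_nhds ⟨z0, hz0, ?_⟩ ?_
  · filter_upwards [hnear z0 hz0 hfz0] with w hw using hHf w hw.1 hw.2
  rintro z ⟨hzc, hz⟩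
  by_cases hfz : f z = 0
  swap
  · show ∀ᶠ w in nhds z, f w = H w
    filter_upwards [hnear z hz hfz] with w hw using hHf w hw.1 hw.2
  have hfr : ∃ᶠ w in nhds z, f w = H w := by
    rw [mem_closure_iff_frequently] at hzc
    refine hzc.mono fun w hw => ?_
    have hw' : ∀ᶠ x in nhds w, f x = H x := hw
    exact hw'.self_of_nhds
  have hHz : H z = 0 := by
    by_contra hne
    have hc : ContinuousAt (fun w => f w - H w) z := (hcat z hz).sub (hHc z hz)
    have : f z - H z ≠ 0 := by rw [hfz]; simpa using hne
    obtain ⟨w, hw, hw'⟩ := (hfr.and_eventually (hc.eventually_ne this)).exists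
    exact hw' (sub_eq_zero.2 hw)
  rcases (hHa z hz).eventually_eq_zero_or_eventually_ne_zero with h0 | h0
  · exfalso
    have := hHa.eqOn_zero_of_preconnected_of_eventuallyEq_zero (convex_ball _ _).isPreconnected
      hz h0 hz0
    exact hfz0 ((hHf z0 hz0 hfz0).trans this)
  · rw [eventually_nhdsWithin_iff] at h0
    obtain ⟨δ, hδ, hsub⟩ := Metric.eventually_nhds_iff_ball.1
      (h0.and (isOpen_ball.mem_nhds hz))
    set W : Set ℂ := ball z δ \ {z} with hW
    have hWo : IsOpen W := isOpen_ball.sdiff isClosed_singleton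
    have hWb : ∀ w ∈ W, w ∈ ball (0:ℂ) R := fun w hw => (hsub w hw.1).2
    have hWH : ∀ w ∈ W, H w ≠ 0 := fun w hw => (hsub w hw.1).1 hw.2
    have o1 : IsOpen (W ∩ {w | f w ≠ 0}) :=
      (hfb.mono hWb).isOpen_inter_preimage hWo (isOpen_compl_singleton (x := (0:ℂ)))
    have o2 : IsOpen (W ∩ {w | f w - H w ≠ 0}) :=
      ((hfb.sub hHd.continuousOn).mono hWb).isOpen_inter_preimage hWo
        (isOpen_compl_singleton (x := (0:ℂ)))
    have hcov : W ⊆ (W ∩ {w | f w ≠ 0}) ∪ (W ∩ {w | f w - H w ≠ 0}) := by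
      intro w hw
      by_cases hfw : f w = 0
      · right
        refine ⟨hw, ?_⟩
        show f w - H w ≠ 0
        rw [hfw]; simpa using hWH w hw
      · exact Or.inl ⟨hw, hfw⟩
    have hne1 : (W ∩ (W ∩ {w | f w ≠ 0})).Nonempty := by
      rw [mem_closure_iff_frequently] at hzc
      obtain ⟨t, ht, htb⟩ := (hzc.and_eventually (ball_mem_nhds z hδ)).exists
      have ht' : ∀ᶠ w in nhds t, f w = H w ∧ w ∈ ball z δ :=
        Filter.Eventually.and ht (isOpen_ball.mem_nhds htb)
      obtain ⟨ρ, hρ, hs⟩ := Metric.eventually_nhds_iff_ball.1 ht'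
      have hx : ∃ w ∈ ball t ρ, w ≠ z := by
        by_cases htz : t = z
        · refine ⟨t + ((ρ/2 : ℝ):ℂ), ?_, ?_⟩
          · simp [dist_eq_norm, abs_of_pos hρ]; linarith
          · rw [htz]; simp [hρ.ne']
        · exact ⟨t, mem_ball_self hρ, htz⟩
      obtain ⟨w, hw, hwz⟩ := hx
      have hwW : w ∈ W := ⟨(hs w hw).2, hwz⟩
      refine ⟨w, hwW, hwW, ?_⟩
      show f w ≠ 0
      rw [(hs w hw).1]
      exact hWH w hwW
    have hWall : ∀ w ∈ W, f w = H w := by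
      intro w hw
      by_contra hne
      obtain ⟨x, hx, hx1, hx2⟩ := isPreconnected_punctured_ball z hδ _ _ o1 o2 hcov hne1
        ⟨w, hw, hw, sub_ne_zero.2 hne⟩
      exact hx2.2 (sub_eq_zero.2 (hHf x (hWb x hx) hx1.2))
    show ∀ᶠ w in nhds z, f w = H w
    filter_upwards [ball_mem_nhds z hδ] with w hw
    by_cases hwz : w = z
    · rw [hwz, hfz, hHz]
    · exact hWall w ⟨hw, hwz⟩


lemma torusMap_mem_sphere_coord {n : ℕ} (c : Fin n → ℂ) {R : ℝ} (hR : 0 < R) (θ : Fin n → ℝ)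
    (i : Fin n) : ‖torusMap c (fun _ => R) θ i - c i‖ = R := by
  simp [torusMap, Complex.norm_exp_ofReal_mul_I, abs_of_pos hR]

lemma torusMap_mem_closedBall' {n : ℕ} (c : Fin n → ℂ) {R : ℝ} (hR : 0 < R) (θ : Fin n → ℝ) :
    torusMap c (fun _ => R) θ ∈ closedBall c R := by
  rw [mem_closedBall, dist_pi_le_iff hR.le]
  intro i
  rw [dist_eq_norm, torusMap_mem_sphere_coord c hR]

lemma continuous_torusMap' {n : ℕ} (c : Fin n → ℂ) (R : Fin n → ℝ) :
    Continuous (torusMap c R) := by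
  unfold torusMap
  fun_prop

lemma torus_cauchy {R : ℝ} (hR : 0 < R) : ∀ {n : ℕ} (c : Fin n → ℂ) (f : (Fin n → ℂ) → ℂ)
    (_ : ContinuousOn f (closedBall c R))
    (_ : ∀ z ∈ closedBall c R, ∀ i,
      DifferentiableOn ℂ (fun t => f (Function.update z i t)) (ball (c i) R))
    (w : Fin n → ℂ) (_ : w ∈ ball c R),
    torusIntegral (fun x => (∏ i, (x i - w i)⁻¹) * f x) c (fun _ => R)
      = (2 * Real.pi * Complex.I) ^ n * f w := by
  intro n
  induction n with
  | zero =>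
    intro c f hf hs w hw
    simp
    exact congrArg f (Subsingleton.elim _ _)
  | succ n ih =>
    intro c f hf hs w hw
    have hwi : ∀ i, dist (w i) (c i) < R := (dist_pi_lt_iff hR).1 hw
    rw [torusIntegral_succ]
    · have hc : (fun (_ : Fin (n+1)) => R) ∘ Fin.succ = fun _ => R := rfl
      have hcons : ∀ x ∈ closedBall (c 0) R, ∀ y ∈ closedBall (c ∘ Fin.succ) R,
          (Fin.cons x y : Fin (n+1) → ℂ) ∈ closedBall c R := by
        intro x hx y hy
        rw [mem_closedBall, dist_pi_le_iff hR.le] at hy ⊢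
        intro i
        refine Fin.cases ?_ (fun j => ?_) i
        · simpa using hx
        · simpa using hy j
      have hw' : w ∘ Fin.succ ∈ ball (c ∘ Fin.succ) R :=
        (dist_pi_lt_iff hR).2 fun i => hwi i.succ
      have hin : ∀ x ∈ sphere (c 0) R,
          torusIntegral (fun y => (∏ i, ((Fin.cons x y : Fin (n+1) → ℂ) i - w i)⁻¹) *
            f (Fin.cons x y)) (c ∘ Fin.succ) (fun _ => R)
          = (x - w 0)⁻¹ • ((2 * Real.pi * Complex.I) ^ n * f (Fin.cons x (w ∘ Fin.succ))) := by
        intro x hx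
        have hx' := sphere_subset_closedBall hx
        have h1 := ih (c ∘ Fin.succ) (fun y => f (Fin.cons x y)) ?_ ?_ (w ∘ Fin.succ) hw'
        · rw [← h1, ← torusIntegral_smul]
          congr 1
          ext y
          simp [Fin.prod_univ_succ, mul_assoc]
          try ring
        · refine hf.comp ?_ (fun y hy => hcons x hx' y hy)
          exact (continuous_pi (fun i => Fin.cases (by simpa using continuous_const)
            (fun j => by simpa using continuous_apply j) i)).continuousOn
        · intro z hz i
          have := hs (Fin.cons x z) (hcons x hx' z hz) i.succ
          simpa [Fin.cons_update] using this
      rw [hc, circleIntegral.integral_congr hR.le hin]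
      have hd : DiffContOnCl ℂ (fun x => (2 * Real.pi * Complex.I) ^ n *
          f (Fin.cons x (w ∘ Fin.succ))) (ball (c 0) R) := by
        have hwc := ball_subset_closedBall hw'
        constructor
        · have := hs (Fin.cons (c 0) (w ∘ Fin.succ))
            (hcons _ (mem_closedBall_self hR.le) _ hwc) 0
          simp only [Fin.update_cons_zero] at this
          exact this.const_mul _
        · refine continuousOn_const.mul ?_
          refine hf.comp ?_ (fun x hx => hcons x (closure_ball_subset_closedBall hx) _ hwc)
          exact (continuous_pi (fun i => Fin.cases (by simpa using continuous_id')
            (fun j => by simpa using continuous_const) i)).continuousOn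
      rw [hd.circleIntegral_sub_inv_smul (hwi 0)]
      have : (Fin.cons (w 0) (w ∘ Fin.succ) : Fin (n+1) → ℂ) = w := Fin.cons_self_tail w
      rw [this, smul_eq_mul, pow_succ]; ring
    · have hk : IsCompact (Icc (0 : Fin (n+1) → ℝ) fun _ => 2 * Real.pi) := isCompact_Icc
      refine ContinuousOn.integrableOn_compact hk ?_
      have hct := continuous_torusMap' c (fun _ => R)
      refine ContinuousOn.mul ?_ (hf.comp hct.continuousOn
        (fun θ _ => torusMap_mem_closedBall' c hR θ))
      refine continuousOn_finsetProd _ fun i _ => ?_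
      refine ContinuousOn.inv₀ ?_ ?_
      · exact (((continuous_apply i).comp hct).sub continuous_const).continuousOn
      · intro θ _ h0
        have h1 := torusMap_mem_sphere_coord c hR θ i
        rw [sub_eq_zero.1 h0, ← dist_eq_norm] at h1
        exact (hwi i).ne h1

theorem osgood {n : ℕ} {f : (Fin n → ℂ) → ℂ} {c : Fin n → ℂ} {R : ℝ} (hR : 0 < R)
    (hf : ContinuousOn f (closedBall c R))
    (hs : ∀ z ∈ closedBall c R, ∀ i,
      DifferentiableOn ℂ (fun t => f (Function.update z i t)) (ball (c i) R)) :
    AnalyticAt ℂ f c := by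
  let K : Set (Fin n → ℝ) := Icc (0 : Fin n → ℝ) fun _ => 2 * Real.pi
  have hK : IsCompact K := isCompact_Icc
  have : CompactSpace K := isCompact_iff_compactSpace.1 hK
  let μ : MeasureTheory.Measure K := MeasureTheory.Measure.comap Subtype.val MeasureTheory.volume
  have hμ : MeasureTheory.IsFiniteMeasure μ := by
    constructor
    have : μ univ = MeasureTheory.volume K := by
      rw [comap_subtype_coe_apply hK.measurableSet]; simp
    rw [this]
    exact hK.measure_lt_top
  let I : C(K, ℂ) →L[ℂ] ℂ := LinearMap.mkContinuous
    { toFun := fun h => ∫ θ, h θ ∂μ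
      map_add' := fun g h => MeasureTheory.integral_add
        (g.continuous.integrable_of_hasCompactSupport (HasCompactSupport.of_compactSpace _))
        (h.continuous.integrable_of_hasCompactSupport (HasCompactSupport.of_compactSpace _))
      map_smul' := fun a h => MeasureTheory.integral_smul a _ } (μ.real univ) (by
      intro h
      have := MeasureTheory.norm_integral_le_of_norm_le_const (μ := μ) (f := h) (C := ‖h‖)
        (Filter.Eventually.of_forall fun θ => h.norm_coe_le_norm θ)
      rw [mul_comm]
      exact this)
  have hct := continuous_torusMap' c (fun _ => R)
  let e : Fin n → C(K, ℂ) := fun i => ⟨fun θ => torusMap c (fun _ => R) θ i,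
    (continuous_apply i).comp (hct.comp continuous_subtype_val)⟩
  let g : C(K, ℂ) := ⟨fun θ => (∏ i : Fin n, (R : ℂ) * Complex.exp ((θ : Fin n → ℝ) i * Complex.I) * Complex.I) *
      f (torusMap c (fun _ => R) θ), by
    refine Continuous.mul (continuous_finsetProd _ fun i _ => ?_) ?_
    · have h1 : Continuous fun θ : K => (((θ : Fin n → ℝ) i : ℝ) : ℂ) :=
        Complex.continuous_ofReal.comp ((continuous_apply i).comp continuous_subtype_val)
      exact (continuous_const.mul (Complex.continuous_exp.comp (h1.mul continuous_const))).mul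
        continuous_const
    exact hf.comp_continuous (hct.comp continuous_subtype_val)
      (fun θ => torusMap_mem_closedBall' c hR θ)⟩
  have hunit : ∀ w ∈ ball c R, ∀ i, IsUnit (e i - algebraMap ℂ C(K, ℂ) (w i)) := by
    intro w hw i
    rw [ContinuousMap.isUnit_iff_forall_ne_zero]
    intro θ h0
    have h1 := torusMap_mem_sphere_coord c hR θ i
    have hwi : dist (w i) (c i) < R := (dist_pi_lt_iff hR).1 hw i
    have h2 : torusMap c (fun _ => R) θ i = w i := by
      simpa [e, sub_eq_zero] using h0
    rw [h2, ← dist_eq_norm] at h1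
    exact hwi.ne h1
  have hform : ∀ w ∈ ball c R, f w = ((2 * Real.pi * Complex.I) ^ n)⁻¹ *
      I ((∏ i, Ring.inverse (e i - algebraMap ℂ C(K, ℂ) (w i))) * g) := by
    intro w hw
    have h1 := torus_cauchy hR c f hf hs w hw
    have h2 : I ((∏ i, Ring.inverse (e i - algebraMap ℂ C(K, ℂ) (w i))) * g) =
        torusIntegral (fun x => (∏ i, (x i - w i)⁻¹) * f x) c (fun _ => R) := by
      unfold torusIntegral
      rw [← MeasureTheory.integral_subtype_comap hK.measurableSet]
      show ∫ θ, _ ∂μ = ∫ θ, _ ∂μ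
      congr 1
      ext θ
      have hinv : ∀ i, (Ring.inverse (e i - algebraMap ℂ C(K, ℂ) (w i))) θ =
          (torusMap c (fun _ => R) θ i - w i)⁻¹ := by
        intro i
        have h3 := Ring.mul_inverse_cancel _ (hunit w hw i)
        have h4 := congrArg (fun h : C(K, ℂ) => h θ) h3
        simp only [ContinuousMap.mul_apply, ContinuousMap.one_apply] at h4
        refine eq_inv_of_mul_eq_one_right ?_
        simpa [e] using h4
      simp only [ContinuousMap.mul_apply, ContinuousMap.coe_prod, Finset.prod_apply, hinv, g,
        ContinuousMap.coe_mk, smul_eq_mul]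
      ring
    rw [h2, h1]
    have : (2 * Real.pi * Complex.I) ^ n ≠ 0 := pow_ne_zero _ Complex.two_pi_I_ne_zero
    field_simp
  have han : AnalyticAt ℂ (fun w : Fin n → ℂ => ((2 * Real.pi * Complex.I) ^ n)⁻¹ *
      I ((∏ i, Ring.inverse (e i - algebraMap ℂ C(K, ℂ) (w i))) * g)) c := by
    refine analyticAt_const.mul ?_
    refine AnalyticAt.comp (I.analyticAt _) ?_
    refine AnalyticAt.mul ?_ analyticAt_const
    refine Finset.analyticAt_fun_prod _ fun i _ => ?_
    have hu := hunit c (mem_ball_self hR) i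
    refine AnalyticAt.comp (g := Ring.inverse)
      (f := fun w : Fin n → ℂ => e i - algebraMap ℂ C(K, ℂ) (w i)) ?_ ?_
    · have := analyticAt_inverse (𝕜 := ℂ) hu.unit
      simpa using this
    · refine analyticAt_const.sub ?_
      exact ((Algebra.linearMap ℂ C(K,ℂ)).toContinuousLinearMap.comp
        (ContinuousLinearMap.proj i : (Fin n → ℂ) →L[ℂ] ℂ)).analyticAt c
  refine han.congr ?_
  filter_upwards [ball_mem_nhds c hR] with w hw using (hform w hw).symm

lemma log_ofReal_le_iff (x r : ℝ) :
    ENNReal.log (ENNReal.ofReal x) ≤ (r : EReal) ↔ x ≤ Real.exp r := by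
  have h : (r : EReal) = ENNReal.log (ENNReal.ofReal (Real.exp r)) := by
    rw [ENNReal.log_ofReal_of_pos (Real.exp_pos r), Real.log_exp]
  rw [h, ENNReal.log_le_log_iff, ENNReal.ofReal_le_ofReal_iff (Real.exp_pos r).le]

lemma le_log_ofReal (x r : ℝ) (h : Real.exp r ≤ x) :
    (r : EReal) ≤ ENNReal.log (ENNReal.ofReal x) := by
  have h' : (r : EReal) = ENNReal.log (ENNReal.ofReal (Real.exp r)) := by
    rw [ENNReal.log_ofReal_of_pos (Real.exp_pos r), Real.log_exp]
  rw [h']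
  exact ENNReal.log_le_log (ENNReal.ofReal_le_ofReal h)

theorem pluripolar_of_seq {n : ℕ} (P : ℕ → (Fin n → ℂ) → ℂ) (hP : ∀ k, Differentiable ℂ (P k))
    (N Dg : ℕ → ℕ) (hN : ∀ k, 0 < N k) (hDN : ∀ k, Dg k * 2 ^ (k + 1) ≤ N k)
    (hb : ∀ k z, ‖P k z‖ ≤ (max 1 ‖z‖) ^ (Dg k))
    (z₀ : Fin n → ℂ) (c₀ : ℝ) (hc₀ : 0 < c₀)
    (hz₀ : ∀ K, c₀ ≤ ∏ k ∈ Finset.range K, ‖P k z₀‖ ^ (1 / (N k : ℝ)))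
    (E : Set (Fin n → ℂ))
    (hE : ∀ z ∈ E, ∀ k₀, ∃ k ≥ k₀, ‖P k z‖ ^ (1 / (N k : ℝ)) ≤ Real.exp (-1)) :
    Pluripolar E := by
  let ρ : (Fin n → ℂ) → ℝ := fun z => max 1 ‖z‖
  have hρ1 : ∀ z, 1 ≤ ρ z := fun z => le_max_left _ _
  have hρ0 : ∀ z, 0 < ρ z := fun z => zero_lt_one.trans_le (hρ1 z)
  let V : ℕ → (Fin n → ℂ) → ℝ := fun K z => ∏ k ∈ Finset.range K, ‖P k z‖ ^ (1 / (N k : ℝ))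
  let U : ℕ → (Fin n → ℂ) → ℝ := fun K z => ρ z ^ ((1 / 2 : ℝ) ^ K) * V K z
  have hV0 : ∀ K z, 0 ≤ V K z := fun K z => Finset.prod_nonneg fun k _ => by positivity
  have hU0 : ∀ K z, 0 ≤ U K z := fun K z => mul_nonneg (Real.rpow_nonneg (hρ0 z).le _) (hV0 K z)
  have hVU : ∀ K z, V K z ≤ U K z := fun K z =>
    le_mul_of_one_le_left (hV0 K z) (Real.one_le_rpow (hρ1 z) (by positivity))
  have hstep : ∀ K z, U (K+1) z = U K z * (ρ z ^ (-((1 / 2 : ℝ) ^ (K+1))) *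
      ‖P K z‖ ^ (1 / (N K : ℝ))) := by
    intro K z
    have h1 : ρ z ^ ((1 / 2 : ℝ) ^ (K+1)) = ρ z ^ ((1 / 2 : ℝ) ^ K) *
        ρ z ^ (-((1 / 2 : ℝ) ^ (K+1))) := by
      rw [← Real.rpow_add (hρ0 z)]; congr 1; rw [pow_succ]; ring
    simp only [U, V, Finset.prod_range_succ, h1]; ring
  have hWle : ∀ k z, ‖P k z‖ ^ (1 / (N k : ℝ)) ≤ ρ z ^ ((1 / 2 : ℝ) ^ (k+1)) := by
    intro k z
    have hNk : (0 : ℝ) < N k := by exact_mod_cast hN k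
    have h1 : ‖P k z‖ ^ (1 / (N k : ℝ)) ≤ ((ρ z) ^ (Dg k)) ^ (1 / (N k : ℝ)) :=
      Real.rpow_le_rpow (norm_nonneg _) (hb k z) (by positivity)
    refine h1.trans ?_
    rw [← Real.rpow_natCast, ← Real.rpow_mul (hρ0 z).le]
    refine Real.rpow_le_rpow_of_exponent_le (hρ1 z) ?_
    have h2 : (Dg k : ℝ) * 2 ^ (k+1) ≤ N k := by exact_mod_cast hDN k
    rw [one_div_pow, mul_one_div, div_le_div_iff₀ hNk (by positivity)]
    linarith
  have hfac : ∀ k z, ρ z ^ (-((1 / 2 : ℝ) ^ (k+1))) * ‖P k z‖ ^ (1 / (N k : ℝ)) ≤ 1 := by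
    intro k z
    rw [Real.rpow_neg (hρ0 z).le, inv_mul_le_iff₀ (Real.rpow_pos_of_pos (hρ0 z) _), mul_one]
    exact hWle k z
  have hanti : ∀ z, Antitone fun K => U K z := by
    intro z
    refine antitone_nat_of_succ_le fun K => ?_
    rw [hstep]
    exact mul_le_of_le_one_right (hU0 K z) (hfac K z)
  have hUc : ∀ K, Continuous (U K) := by
    intro K
    refine Continuous.mul ?_ ?_
    · exact (continuous_const.max continuous_norm).rpow_const fun z => Or.inl (hρ0 z).ne'
    · refine continuous_finsetProd _ fun k _ => ?_
      exact ((hP k).continuous.norm).rpow_const fun z => Or.inr (by positivity)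
  let u : (Fin n → ℂ) → EReal := fun z => ⨅ K, ENNReal.log (ENNReal.ofReal (U K z))
  have hule : ∀ K z (r : ℝ), U K z ≤ Real.exp r → u z ≤ (r : EReal) := fun K z r h =>
    (iInf_le _ K).trans ((log_ofReal_le_iff _ _).2 h)
  have husc : UpperSemicontinuous u := by
    refine upperSemicontinuous_iInf fun K => ?_
    exact ((ENNReal.continuous_log.comp
      (ENNReal.continuous_ofReal.comp (hUc K)))).upperSemicontinuous
  refine ⟨u, ⟨husc, ?_, ?_⟩, ?_, ?_⟩
  · intro z h
    have := hule 0 z (Real.log (max 1 (U 0 z))) (by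
      rw [Real.exp_log (by positivity)]; exact le_max_right _ _)
    rw [h] at this
    exact (EReal.coe_lt_top _).not_ge this
  · intro a b
    have hline : Continuous fun t : ℂ => a + t • b := by fun_prop
    refine ⟨UpperSemicontinuous.upperSemicontinuousOn
      (UpperSemicontinuous.comp husc hline) _, ?_⟩
    intro c r hr _ p hsph z hz
    by_contra hcon
    push Not at hcon
    obtain ⟨y, hy1, hy2⟩ := EReal.lt_iff_exists_real_btwn.1 hcon
    rw [EReal.coe_lt_coe_iff] at hy1
    obtain ⟨δ, hδ⟩ : ∃ δ, δ = (y - (p.eval z).re) / 2 := ⟨_, rfl⟩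
    have hδ0 : 0 < δ := by rw [hδ]; linarith
    -- Dini
    have hDini : ∃ K₀, ∀ t ∈ sphere c r, U K₀ (a + t • b) < Real.exp ((p.eval t).re + δ) := by
      have h1 := (isCompact_sphere c r).elim_directed_family_closed
        (fun K => {t | Real.exp ((p.eval t).re + δ) ≤ U K (a + t • b)}) (fun K => by
          refine isClosed_le ?_ ((hUc K).comp hline)
          exact Real.continuous_exp.comp ((Complex.continuous_re.comp p.continuous).add
            continuous_const)) (by
          rw [Set.eq_empty_iff_forall_notMem]
          rintro t ⟨ht, ht2⟩
          rw [Set.mem_iInter] at ht2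
          have h3 : (((p.eval t).re + δ : ℝ) : EReal) ≤ u (a + t • b) :=
            le_iInf fun K => le_log_ofReal _ _ (ht2 K)
          have h4 := h3.trans (hsph t ht)
          rw [EReal.coe_le_coe_iff] at h4
          linarith) (directed_of_isDirected_le fun i j hij t ht => le_trans ht (hanti _ hij))
      obtain ⟨K, hK⟩ := h1
      refine ⟨K, fun t ht => ?_⟩
      by_contra h2
      push Not at h2
      exact Set.eq_empty_iff_forall_notMem.1 hK t ⟨ht, h2⟩
    obtain ⟨K₀, hK₀⟩ := hDini
    have hR : ∃ K ≥ K₀, ρ (a + z • b) ^ ((1 / 2 : ℝ) ^ K) ≤ Real.exp δ := by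
      have h1 : Filter.Tendsto (fun K : ℕ => ρ (a + z • b) ^ ((1 / 2 : ℝ) ^ K)) Filter.atTop
          (nhds (ρ (a + z • b) ^ (0 : ℝ))) :=
        (Real.continuousAt_const_rpow (hρ0 (a + z • b)).ne').tendsto.comp
          (tendsto_pow_atTop_nhds_zero_of_lt_one (by norm_num) (by norm_num))
      rw [Real.rpow_zero] at h1
      have h2 := h1.eventually (gt_mem_nhds (Real.one_lt_exp_iff.2 hδ0))
      obtain ⟨K, hK1, hK2⟩ := (h2.and (Filter.eventually_ge_atTop K₀)).exists
      exact ⟨K, hK2, hK1.le⟩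
    obtain ⟨K, hKK, hKρ⟩ := hR
    have hsphV : ∀ t ∈ sphere c r, V K (a + t • b) ≤ Real.exp ((p.eval t).re + δ) := fun t ht =>
      (hVU K _).trans ((hanti _ hKK).trans (hK₀ t ht).le)
    let NN : ℕ := ∏ k ∈ Finset.range K, N k
    have hNN : 0 < NN := Finset.prod_pos fun k _ => hN k
    have hNNr : (0 : ℝ) < NN := by exact_mod_cast hNN
    let Q : ℂ → ℂ := fun t => ∏ k ∈ Finset.range K, P k (a + t • b) ^ (NN / N k)
    have hQV : ∀ t, ‖Q t‖ = V K (a + t • b) ^ NN := by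
      intro t
      simp only [Q, V, norm_prod, norm_pow, ← Finset.prod_pow]
      refine Finset.prod_congr rfl fun k hk => ?_
      have hNk : (0 : ℝ) < N k := by exact_mod_cast hN k
      rw [← Real.rpow_natCast, ← Real.rpow_natCast, ← Real.rpow_mul (norm_nonneg _),
        Nat.cast_div (Finset.dvd_prod_of_mem N hk) hNk.ne']
      congr 1; ring
    have hQd : Differentiable ℂ Q := by
      intro t
      refine DifferentiableAt.fun_finsetProd fun k _ => ?_
      refine DifferentiableAt.pow ?_ _
      exact ((hP k) _).comp t (by fun_prop)
    let F : ℂ → ℂ := fun t => Q t * Complex.exp (-(NN * (p.eval t + δ)))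
    have hFd : Differentiable ℂ F := by
      refine hQd.mul ?_
      refine Differentiable.cexp ?_
      exact ((p.differentiable.add_const _).const_mul _).neg
    have hFn : ∀ t, ‖F t‖ = V K (a + t • b) ^ NN * (Real.exp ((p.eval t).re + δ) ^ NN)⁻¹ := by
      intro t
      simp only [F, norm_mul, hQV, Complex.norm_exp]
      congr 1
      rw [← Real.exp_nat_mul, ← Real.exp_neg]
      simp
    have hle : ‖F z‖ ≤ 1 := by
      refine Complex.norm_le_of_forall_mem_frontier_norm_le (U := ball c r) isBounded_ball
        hFd.diffContOnCl ?_ ?_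
      · intro t ht
        rw [frontier_ball c hr.ne'] at ht
        rw [hFn, mul_inv_le_iff₀ (by positivity), one_mul]
        exact pow_le_pow_left₀ (hV0 _ _) (hsphV t ht) _
      · rw [closure_ball c hr.ne']; exact hz
    rw [hFn, mul_inv_le_iff₀ (by positivity), one_mul,
      pow_le_pow_iff_left₀ (hV0 _ _) (Real.exp_pos _).le hNN.ne'] at hle
    have hfin : U K (a + z • b) ≤ Real.exp y := by
      have : Real.exp y = Real.exp δ * Real.exp ((p.eval z).re + δ) := by
        rw [← Real.exp_add]; congr 1; rw [hδ]; ring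
      rw [this]
      exact mul_le_mul hKρ hle (hV0 _ _) (Real.exp_pos _).le
    exact (hule K _ y hfin).not_gt hy2
  · intro h
    have h1 : ((Real.log c₀ : ℝ) : EReal) ≤ u z₀ :=
      le_iInf fun K => le_log_ofReal _ _ (by
        rw [Real.exp_log hc₀]; exact (hz₀ K).trans (hVU K z₀))
    rw [h z₀] at h1
    exact (EReal.bot_lt_coe _).not_ge h1
  · intro z hz
    have h1 : ∀ j : ℕ, ∃ K, U K z ≤ U 0 z * Real.exp (-1) ^ j := by
      intro j
      induction j with
      | zero => exact ⟨0, by simp⟩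
      | succ j ih =>
        obtain ⟨K, hK⟩ := ih
        obtain ⟨k, hk, hk2⟩ := hE z hz K
        refine ⟨k + 1, ?_⟩
        rw [hstep]
        have h2 : ρ z ^ (-((1 / 2 : ℝ) ^ (k+1))) ≤ 1 :=
          Real.rpow_le_one_of_one_le_of_nonpos (hρ1 z) (by simp)
        have h3 : ρ z ^ (-((1 / 2 : ℝ) ^ (k+1))) * ‖P k z‖ ^ (1 / (N k : ℝ)) ≤ Real.exp (-1) :=
          (mul_le_of_le_one_left (by positivity) h2).trans hk2
        have h4 : U k z ≤ U 0 z * Real.exp (-1) ^ j := (hanti z hk).trans hK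
        have h5 : 0 ≤ U 0 z * Real.exp (-1) ^ j := (hU0 k z).trans h4
        rw [pow_succ (Real.exp (-1)) j, ← mul_assoc (U 0 z)]
        exact mul_le_mul h4 h3
          (mul_nonneg (Real.rpow_nonneg (hρ0 z).le _) (by positivity)) h5
    rw [EReal.eq_bot_iff_forall_lt]
    intro y
    have h2 : Filter.Tendsto (fun j : ℕ => U 0 z * Real.exp (-1) ^ j) Filter.atTop
        (nhds (U 0 z * 0)) :=
      (tendsto_pow_atTop_nhds_zero_of_lt_one (Real.exp_pos _).le
        (by rw [Real.exp_lt_one_iff]; norm_num)).const_mul _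
    rw [mul_zero] at h2
    obtain ⟨j, hj⟩ := (h2.eventually (gt_mem_nhds (Real.exp_pos (y - 1)))).exists
    obtain ⟨K, hK⟩ := h1 j
    refine (hule K z (y - 1) (hK.trans hj.le)).trans_lt ?_
    rw [EReal.coe_lt_coe_iff]; linarith

lemma prod_pow_div_eq {x : ℕ → ℝ} (hx : ∀ k, 0 ≤ x k) {N : ℕ → ℕ} (hN : ∀ k, 0 < N k) (K : ℕ) :
    ∏ k ∈ Finset.range K, x k ^ ((∏ k ∈ Finset.range K, N k) / N k) =
      (∏ k ∈ Finset.range K, x k ^ (1 / (N k : ℝ))) ^ (∏ k ∈ Finset.range K, N k) := by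
  rw [← Finset.prod_pow]
  refine Finset.prod_congr rfl fun k hk => ?_
  have hNk : (0 : ℝ) < N k := by exact_mod_cast hN k
  rw [← Real.rpow_natCast, ← Real.rpow_natCast, ← Real.rpow_mul (hx k),
    Nat.cast_div (Finset.dvd_prod_of_mem N hk) hNk.ne']
  congr 1; ring

lemma exists_mahlerMeasure_le (p : ℂ[X]) : ∃ ζ : ℂ, ‖ζ‖ = 1 ∧ p.mahlerMeasure ≤ ‖p.eval ζ‖ := by
  obtain ⟨ζ, hζ, hmax⟩ := (isCompact_sphere (0:ℂ) 1).exists_isMaxOn ⟨1, by simp⟩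
    (p.continuous.norm.continuousOn)
  refine ⟨ζ, by simpa using hζ, ?_⟩
  by_cases hp : p = 0
  · simp [hp]
  have hfin : {x : ℝ | eval (circleMap 0 1 x) p = 0 ∧ x ∈ Ico 0 (2 * Real.pi)}.Finite := by
    apply Finite.of_finite_image (f := circleMap 0 1) ((Multiset.finite_toSet p.roots).subset _)
      <| fun _ h _ k l ↦ injOn_circleMap_of_abs_sub_le' one_ne_zero (by linarith) h.2 k.2 l
    rintro _ ⟨x, hx, rfl⟩
    simp only [Set.mem_ofPred_eq, Polynomial.mem_roots hp, Polynomial.IsRoot]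
    exact hx.1
  have hle : ∀ x : ℝ, ‖eval (circleMap 0 1 x) p‖ ≤ ‖p.eval ζ‖ := fun x =>
    hmax (circleMap_mem_sphere 0 zero_le_one x)
  have hpos : 0 < ‖p.eval ζ‖ := by
    by_contra h
    have h0 : ∀ z : ℂ, ‖z‖ = 1 → p.eval z = 0 := by
      intro z hz
      have := hmax (a := z) (by simpa using hz)
      simp only [Set.mem_ofPred_eq] at this
      exact norm_le_zero_iff.1 (this.trans (not_lt.1 h))
    refine (Set.infinite_of_injOn_mapsTo (s := Ico (0:ℝ) 1) (f := fun x => x)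
      (fun _ _ _ _ h => h) ?_ (Set.Ico_infinite one_pos)) hfin
    intro x hx
    refine ⟨h0 _ (by simp), hx.1, hx.2.trans ?_⟩
    linarith [Real.pi_gt_three]
  rw [show ‖p.eval ζ‖ = Real.exp (Real.circleAverage (fun _ ↦ Real.log ‖p.eval ζ‖) 0 1)
    by simp [Real.circleAverage_def, mul_assoc, Real.exp_log hpos], mahlerMeasure_def_of_ne_zero hp,
    Real.circleAverage_def, smul_eq_mul]
  gcongr
  apply intervalIntegral.integral_mono_ae_restrict (by positivity)
    p.intervalIntegrable_mahlerMeasure (by simp)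
  rw [Filter.EventuallyLE, Filter.eventually_iff_exists_mem]
  refine ⟨{x : ℝ | eval (circleMap 0 1 x) p ≠ 0}, ?_, ?_⟩
  · rw [MeasureTheory.mem_ae_iff, MeasureTheory.Measure.restrict_apply' (by simp)]
    refine ((hfin.union (Set.finite_singleton (2 * Real.pi))).subset ?_).measure_zero _
    rintro x ⟨hx, hx2⟩
    have hx' : eval (circleMap 0 1 x) p = 0 := by
      by_contra h; exact hx h
    rcases hx2.2.eq_or_lt with h | h
    · right; exact h
    · left; exact ⟨hx', hx2.1, h⟩
  · intro x hx
    exact Real.log_le_log (norm_pos_iff.2 hx) (hle x)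

lemma prod_two_rpow_le (K : ℕ) :
    ∏ k ∈ Finset.range K, (2 : ℝ) ^ ((1 / 2 : ℝ) ^ (k + 1)) = 2 ^ (1 - (1 / 2 : ℝ) ^ K) := by
  induction K with
  | zero => simp
  | succ K ih =>
    rw [Finset.prod_range_succ, ih, ← Real.rpow_add two_pos]
    congr 1; rw [pow_succ]; ring

lemma circle_point (p : ℕ → ℂ[X]) (d N j : ℕ → ℕ) (hd : ∀ k, (p k).natDegree ≤ d k)
    (hp1 : ∀ k (ζ : ℂ), ‖ζ‖ = 1 → ‖(p k).eval ζ‖ ≤ 1)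
    (hN : ∀ k, 0 < N k) (hdN : ∀ k, d k * 2 ^ (k + 1) ≤ N k) (c₀ : ℝ) (hc₀ : 0 < c₀)
    (hc : ∀ K, c₀ ≤ ∏ k ∈ Finset.range K, ‖(p k).coeff (j k)‖ ^ (1 / (N k : ℝ))) :
    ∃ ζ : ℂ, ‖ζ‖ = 1 ∧ ∀ K, c₀ / 2 ≤
      ∏ k ∈ Finset.range K, ‖(p k).eval ζ‖ ^ (1 / (N k : ℝ)) := by
  have hM : ∀ K, c₀ / 2 ≤ ∏ k ∈ Finset.range K, (p k).mahlerMeasure ^ (1 / (N k : ℝ)) := by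
    intro K
    have h1 : ∏ k ∈ Finset.range K, ‖(p k).coeff (j k)‖ ^ (1 / (N k : ℝ)) ≤
        ∏ k ∈ Finset.range K, ((2 : ℝ) ^ ((1 / 2 : ℝ) ^ (k + 1)) *
          (p k).mahlerMeasure ^ (1 / (N k : ℝ))) := by
      refine Finset.prod_le_prod (fun k _ => by positivity) fun k _ => ?_
      have hNk : (0 : ℝ) < N k := by exact_mod_cast hN k
      have h2 : ‖(p k).coeff (j k)‖ ≤ (2 : ℝ) ^ (d k) * (p k).mahlerMeasure := by
        refine (norm_coeff_le_choose_mul_mahlerMeasure _ _).trans ?_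
        refine mul_le_mul_of_nonneg_right ?_ (mahlerMeasure_nonneg _)
        have h3 : (p k).natDegree.choose (j k) ≤ 2 ^ (d k) :=
          (Nat.choose_le_two_pow _ _).trans (Nat.pow_le_pow_right two_pos (hd k))
        exact_mod_cast h3
      refine (Real.rpow_le_rpow (norm_nonneg _) h2 (by positivity)).trans ?_
      rw [Real.mul_rpow (by positivity) (mahlerMeasure_nonneg _)]
      refine mul_le_mul_of_nonneg_right ?_ (Real.rpow_nonneg (mahlerMeasure_nonneg _) _)
      rw [← Real.rpow_natCast, ← Real.rpow_mul two_pos.le]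
      refine Real.rpow_le_rpow_of_exponent_le one_le_two ?_
      have h2 : (d k : ℝ) * 2 ^ (k+1) ≤ N k := by exact_mod_cast hdN k
      rw [one_div_pow, mul_one_div, div_le_div_iff₀ hNk (by positivity)]
      linarith
    rw [Finset.prod_mul_distrib, prod_two_rpow_le] at h1
    have h4 : (2 : ℝ) ^ (1 - (1 / 2 : ℝ) ^ K) ≤ 2 := by
      calc (2 : ℝ) ^ (1 - (1 / 2 : ℝ) ^ K) ≤ 2 ^ (1 : ℝ) :=
            Real.rpow_le_rpow_of_exponent_le one_le_two (by simp)
        _ = 2 := Real.rpow_one 2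
    have h5 : 0 ≤ ∏ k ∈ Finset.range K, (p k).mahlerMeasure ^ (1 / (N k : ℝ)) :=
      Finset.prod_nonneg fun k _ => Real.rpow_nonneg (mahlerMeasure_nonneg _) _
    have h6 := (hc K).trans (h1.trans (mul_le_mul_of_nonneg_right h4 h5))
    linarith
  let t : ℕ → Set ℂ := fun K => sphere (0:ℂ) 1 ∩ {ζ | c₀ / 2 ≤
      ∏ k ∈ Finset.range K, ‖(p k).eval ζ‖ ^ (1 / (N k : ℝ))}
  have hcl : ∀ K, IsClosed (t K) := by
    intro K
    refine isClosed_sphere.inter (isClosed_le continuous_const ?_)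
    refine continuous_finsetProd _ fun k _ => ?_
    exact ((p k).continuous.norm).rpow_const fun z => Or.inr (by positivity)
  obtain ⟨ζ, hζ⟩ := IsCompact.nonempty_iInter_of_sequence_nonempty_isCompact_isClosed t (by
      rintro K ζ ⟨h1, h2⟩
      refine ⟨h1, ?_⟩
      simp only [Set.mem_ofPred_eq, Finset.prod_range_succ] at h2 ⊢
      refine h2.trans (mul_le_of_le_one_right (Finset.prod_nonneg fun k _ => by positivity) ?_)
      exact Real.rpow_le_one (norm_nonneg _) (hp1 K ζ (by simpa using h1)) (by positivity)) (by
      intro K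
      obtain ⟨ζ, h1, h2⟩ := exists_mahlerMeasure_le
        (∏ k ∈ Finset.range K, (p k) ^ ((∏ k ∈ Finset.range K, N k) / N k))
      refine ⟨ζ, by simpa using h1, ?_⟩
      simp only [Set.mem_ofPred_eq]
      let μ : ℂ[X] →* ℝ := ⟨⟨mahlerMeasure, mahlerMeasure_one⟩, mahlerMeasure_mul⟩
      have h3 : (∏ k ∈ Finset.range K, (p k) ^ ((∏ k ∈ Finset.range K, N k) / N k)).mahlerMeasure
          = ∏ k ∈ Finset.range K, (p k).mahlerMeasure ^ ((∏ k ∈ Finset.range K, N k) / N k) := by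
        have := map_prod μ (fun k => (p k) ^ ((∏ k ∈ Finset.range K, N k) / N k)) (Finset.range K)
        simp only [map_pow] at this
        exact this
      rw [h3, Polynomial.eval_prod, norm_prod] at h2
      simp only [eval_pow, norm_pow] at h2
      rw [prod_pow_div_eq (fun k => mahlerMeasure_nonneg _) hN,
        prod_pow_div_eq (fun k => norm_nonneg _) hN, pow_le_pow_iff_left₀
          (Finset.prod_nonneg fun k _ => Real.rpow_nonneg (mahlerMeasure_nonneg _) _)
          (Finset.prod_nonneg fun k _ => by positivity)
          (Finset.prod_pos fun k _ => hN k).ne'] at h2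
      exact (hM K).trans h2) ((isCompact_sphere _ _).of_isClosed_subset (hcl 0) inter_subset_left) hcl
  rw [Set.mem_iInter] at hζ
  exact ⟨ζ, by simpa using (hζ 0).1, fun K => (hζ K).2⟩

/-- Evaluation of a polynomial with the coefficient array `c`. -/
def pev {n d : ℕ} (c : (Fin n → Fin (d + 1)) → ℂ) (z : Fin n → ℂ) : ℂ :=
  ∑ α, c α * ∏ i, z i ^ (α i : ℕ)

lemma pev_cons {n d : ℕ} (c : (Fin (n+1) → Fin (d + 1)) → ℂ) (ζ : ℂ) (z : Fin n → ℂ) :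
    pev c (Fin.cons ζ z) =
      pev (fun β : Fin n → Fin (d+1) => ∑ j : Fin (d+1), c (Fin.cons j β) * ζ ^ (j : ℕ)) z := by
  unfold pev
  rw [← (Fin.consEquiv (fun _ : Fin (n+1) => Fin (d+1))).sum_comp, Fintype.sum_prod_type,
    Finset.sum_comm]
  refine Finset.sum_congr rfl fun β _ => ?_
  rw [Finset.sum_mul]
  refine Finset.sum_congr rfl fun j _ => ?_
  simp [Fin.consEquiv, Fin.prod_univ_succ]
  ring

lemma torus_point (N : ℕ → ℕ) (hN : ∀ k, 0 < N k) (d : ℕ → ℕ)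
    (hdN : ∀ k, d k * 2 ^ (k + 1) ≤ N k) : ∀ {n : ℕ}
    (c : ∀ k, (Fin n → Fin (d k + 1)) → ℂ) (_ : ∀ k, ∑ α, ‖c k α‖ ≤ 1)
    (α : ∀ k, Fin n → Fin (d k + 1)) (c₀ : ℝ) (_ : 0 < c₀)
    (_ : ∀ K, c₀ ≤ ∏ k ∈ Finset.range K, ‖c k (α k)‖ ^ (1 / (N k : ℝ))),
    ∃ z : Fin n → ℂ, ∃ c₁ : ℝ, 0 < c₁ ∧
      ∀ K, c₁ ≤ ∏ k ∈ Finset.range K, ‖pev (c k) z‖ ^ (1 / (N k : ℝ)) := by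
  intro n
  induction n with
  | zero =>
    intro c h1 α c₀ hc₀ h2
    refine ⟨fun _ => 0, c₀, hc₀, fun K => (h2 K).trans (le_of_eq ?_)⟩
    refine Finset.prod_congr rfl fun k _ => ?_
    congr 2
    unfold pev
    rw [Fintype.sum_subsingleton _ (α k)]
    simp
  | succ n ih =>
    intro c h1 α c₀ hc₀ h2
    let p : ℕ → ℂ[X] := fun k => ∑ j : Fin (d k + 1),
      Polynomial.C (c k (Fin.cons j (Fin.tail (α k)))) * X ^ (j : ℕ)
    have hev : ∀ k ζ, (p k).eval ζ =
        ∑ j : Fin (d k + 1), c k (Fin.cons j (Fin.tail (α k))) * ζ ^ (j : ℕ) := by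
      intro k ζ; simp [p, Polynomial.eval_finsetSum]
    have hco : ∀ k, (p k).coeff (α k 0 : ℕ) = c k (α k) := by
      intro k
      simp only [p, Polynomial.finsetSum_coeff, coeff_C_mul, coeff_X_pow]
      rw [Finset.sum_eq_single (α k 0)]
      · simp
      · intro j _ hj
        rw [if_neg (fun h => hj (Fin.ext h.symm)), mul_zero]
      · simp
    have hsum : ∀ k (ζ : ℂ), ‖ζ‖ = 1 → ∑ β : Fin n → Fin (d k + 1),
        ‖∑ j : Fin (d k + 1), c k (Fin.cons j β) * ζ ^ (j : ℕ)‖ ≤ 1 := by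
      intro k ζ hζ
      refine le_trans ?_ (h1 k)
      rw [← (Fin.consEquiv (fun _ : Fin (n+1) => Fin (d k+1))).sum_comp, Fintype.sum_prod_type,
        Finset.sum_comm]
      refine Finset.sum_le_sum fun β _ => ?_
      refine (norm_sum_le _ _).trans (Finset.sum_le_sum fun j _ => ?_)
      simp [hζ, Fin.consEquiv]
    obtain ⟨ζ, hζ, hζK⟩ := circle_point p d N (fun k => (α k 0 : ℕ)) (by
        intro k
        refine Polynomial.natDegree_sum_le_of_forall_le _ _ fun j _ => ?_
        exact (natDegree_C_mul_X_pow_le _ _).trans (Nat.lt_succ_iff.1 j.isLt)) (by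
        intro k ζ hζ
        rw [hev]
        exact (Finset.single_le_sum (f := fun β : Fin n → Fin (d k + 1) =>
          ‖∑ j : Fin (d k + 1), c k (Fin.cons j β) * ζ ^ (j : ℕ)‖)
          (fun _ _ => norm_nonneg _) (Finset.mem_univ (Fin.tail (α k)))).trans (hsum k ζ hζ))
      hN hdN c₀ hc₀ (by simpa only [hco] using h2)
    obtain ⟨z, c₁, hc₁, hz⟩ := ih
      (fun k β => ∑ j : Fin (d k + 1), c k (Fin.cons j β) * ζ ^ (j : ℕ))
      (fun k => hsum k ζ hζ) (fun k => Fin.tail (α k)) (c₀ / 2) (by positivity)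
      (by simpa only [hev] using hζK)
    exact ⟨Fin.cons ζ z, c₁, hc₁, by simpa only [pev_cons] using hz⟩


/-- Sets on which suitably normalised polynomials are as small as desired. -/
def SmallOn {n : ℕ} (E : Set (Fin n → ℂ)) : Prop :=
  ∀ M : ℝ, ∃ d : ℕ, 1 ≤ d ∧ ∃ c : (Fin n → Fin (d + 1)) → ℂ,
    ∑ α, ‖c α‖ = 1 ∧ ∀ z ∈ E, ‖pev c z‖ ≤ Real.exp (-(M * d))

lemma SmallOn.mono {n : ℕ} {E F : Set (Fin n → ℂ)} (h : SmallOn F) (hEF : E ⊆ F) : SmallOn E := by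
  intro M
  obtain ⟨d, hd, c, hc, hz⟩ := h M
  exact ⟨d, hd, c, hc, fun z hz' => hz z (hEF hz')⟩

lemma pev_norm_le {n d : ℕ} (c : (Fin n → Fin (d + 1)) → ℂ) (hc : ∑ α, ‖c α‖ = 1)
    (z : Fin n → ℂ) {ρ : ℝ} (hρ : 1 ≤ ρ) (hz : ∀ i, ‖z i‖ ≤ ρ) : ‖pev c z‖ ≤ ρ ^ (n * d) := by
  unfold pev
  refine (norm_sum_le _ _).trans ?_
  have h1 : ∀ α : Fin n → Fin (d+1), ‖c α * ∏ i, z i ^ (α i : ℕ)‖ ≤ ‖c α‖ * ρ ^ (n * d) := by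
    intro α
    rw [norm_mul]
    refine mul_le_mul_of_nonneg_left ?_ (norm_nonneg _)
    rw [norm_prod]
    calc ∏ i, ‖z i ^ (α i : ℕ)‖ ≤ ∏ _i : Fin n, ρ ^ d := by
          refine Finset.prod_le_prod (fun _ _ => norm_nonneg _) fun i _ => ?_
          rw [norm_pow]
          exact (pow_le_pow_left₀ (norm_nonneg _) (hz i) _).trans
            (pow_le_pow_right₀ hρ (Nat.lt_succ_iff.1 (α i).isLt))
      _ = ρ ^ (n * d) := by simp [← pow_mul, mul_comm]
  refine (Finset.sum_le_sum fun α _ => h1 α).trans ?_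
  rw [← Finset.sum_mul, hc, one_mul]

lemma differentiable_pev {n d : ℕ} (c : (Fin n → Fin (d + 1)) → ℂ) : Differentiable ℂ (pev c) := by
  unfold pev
  intro z
  refine DifferentiableAt.fun_sum fun α _ => ?_
  have h : DifferentiableAt ℂ (fun z : Fin n → ℂ => ∏ i, z i ^ (α i : ℕ)) z := by
    refine AnalyticAt.differentiableAt ?_
    refine Finset.analyticAt_fun_prod _ fun i _ => ?_
    have h : AnalyticAt ℂ (fun z : Fin n → ℂ => z i) z :=
      (ContinuousLinearMap.proj i : (Fin n → ℂ) →L[ℂ] ℂ).analyticAt z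
    exact h.pow _
  exact h.const_mul _

theorem pluripolar_of_smallOn {n : ℕ} (E : ℕ → Set (Fin n → ℂ)) (h : ∀ j, SmallOn (E j)) :
    Pluripolar (⋃ j, E j) := by
  choose d hd c hc hz using fun k : ℕ => h (Nat.unpair k).1 (((n + 1) * 2 ^ (k + 1) : ℕ) : ℝ)
  let N : ℕ → ℕ := fun k => (n + 1) * 2 ^ (k + 1) * d k
  have hN : ∀ k, 0 < N k := fun k => by
    have := hd k
    positivity
  have hdN : ∀ k, d k * 2 ^ (k + 1) ≤ N k := fun k => by
    have : d k * 2 ^ (k+1) ≤ (n + 1) * (d k * 2 ^ (k+1)) := Nat.le_mul_of_pos_left _ (by omega)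
    calc d k * 2 ^ (k + 1) ≤ _ := this
      _ = N k := by simp only [N]; ring
  have hndN : ∀ k, (n * d k) * 2 ^ (k + 1) ≤ N k := fun k => by
    calc (n * d k) * 2 ^ (k + 1) ≤ ((n + 1) * d k) * 2 ^ (k+1) := by gcongr; omega
      _ = N k := by simp only [N]; ring
  have hα : ∀ k, ∃ α : Fin n → Fin (d k + 1), ((2 : ℝ) ^ (n * d k))⁻¹ ≤ ‖c k α‖ := by
    intro k
    have h1 : ∑ _α : Fin n → Fin (d k + 1), ((2 : ℝ) ^ (n * d k))⁻¹ ≤ ∑ α, ‖c k α‖ := by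
      rw [hc k]
      simp only [Finset.sum_const, Finset.card_univ, Fintype.card_fun, Fintype.card_fin,
        nsmul_eq_mul]
      rw [mul_inv_le_iff₀ (by positivity), one_mul, mul_comm, pow_mul]
      push_cast
      refine pow_le_pow_left₀ (by positivity) ?_ _
      have : d k + 1 ≤ 2 ^ d k := Nat.lt_two_pow_self
      exact_mod_cast this
    obtain ⟨α, _, h2⟩ := Finset.exists_le_of_sum_le Finset.univ_nonempty h1
    exact ⟨α, h2⟩
  choose α hα using hα
  have hc0 : ∀ K, (1 / 2 : ℝ) ≤ ∏ k ∈ Finset.range K, ‖c k (α k)‖ ^ (1 / (N k : ℝ)) := by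
    intro K
    have h1 : ∏ k ∈ Finset.range K, ((2 : ℝ) ^ ((1 / 2 : ℝ) ^ (k + 1)))⁻¹ ≤
        ∏ k ∈ Finset.range K, ‖c k (α k)‖ ^ (1 / (N k : ℝ)) := by
      refine Finset.prod_le_prod (fun k _ => by positivity) fun k _ => ?_
      have hNk : (0 : ℝ) < N k := by exact_mod_cast hN k
      refine le_trans ?_ (Real.rpow_le_rpow (by positivity) (hα k) (by positivity))
      rw [Real.inv_rpow (by positivity)]
      refine inv_anti₀ (by positivity) ?_
      rw [← Real.rpow_natCast, ← Real.rpow_mul two_pos.le]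
      refine Real.rpow_le_rpow_of_exponent_le one_le_two ?_
      have h2 : ((n * d k : ℕ) : ℝ) * 2 ^ (k+1) ≤ N k := by exact_mod_cast hndN k
      rw [one_div_pow, mul_one_div, div_le_div_iff₀ hNk (by positivity)]
      linarith
    refine le_trans ?_ h1
    rw [Finset.prod_inv_distrib, prod_two_rpow_le]
    have h3 : (2 : ℝ) ^ (1 - (1 / 2 : ℝ) ^ K) ≤ 2 := by
      calc (2 : ℝ) ^ (1 - (1 / 2 : ℝ) ^ K) ≤ 2 ^ (1 : ℝ) :=
            Real.rpow_le_rpow_of_exponent_le one_le_two (by simp)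
        _ = 2 := Real.rpow_one 2
    calc (1 / 2 : ℝ) = 2⁻¹ := by norm_num
      _ ≤ _ := inv_anti₀ (by positivity) h3
  obtain ⟨z₀, c₁, hc₁, hz₀⟩ := torus_point N hN d hdN c (fun k => (hc k).le) α (1 / 2) (by norm_num) hc0
  refine pluripolar_of_seq (fun k => pev (c k)) (fun k => differentiable_pev _) N
    (fun k => n * d k) hN hndN ?_ z₀ c₁ hc₁ hz₀ _ ?_
  · intro k z
    exact pev_norm_le _ (hc k) z (le_max_left _ _)
      (fun i => (norm_le_pi_norm z i).trans (le_max_right _ _))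
  · intro z hzE k₀
    obtain ⟨j, hj⟩ := Set.mem_iUnion.1 hzE
    refine ⟨Nat.pair j k₀, Nat.right_le_pair j k₀, ?_⟩
    have h1 := hz (Nat.pair j k₀) z (by rw [Nat.unpair_pair]; exact hj)
    have hNk : (0 : ℝ) < N (Nat.pair j k₀) := by exact_mod_cast hN _
    refine (Real.rpow_le_rpow (norm_nonneg _) h1 (by positivity)).trans (le_of_eq ?_)
    rw [← Real.exp_mul]
    congr 1
    have : (((n + 1) * 2 ^ (Nat.pair j k₀ + 1) : ℕ) : ℝ) * (d (Nat.pair j k₀) : ℝ) =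
      N (Nat.pair j k₀) := by simp only [N]; push_cast; ring
    rw [this]
    field_simp

lemma homog_mem_span {k L j : ℕ} (hj : j < L)
    (p : ContinuousMultilinearMap ℂ (fun _ : Fin j => Fin k → ℂ) ℂ) :
    (fun z : Fin k → ℂ => p fun _ => z) ∈
      Submodule.span ℂ (Set.range fun (γ : Fin k → Fin L) (z : Fin k → ℂ) =>
        ∏ i, z i ^ (γ i : ℕ)) := by
  classical
  have h : (fun z : Fin k → ℂ => p fun _ => z) =
      ∑ r : Fin j → Fin k, (p fun i => Pi.single (r i) (1 : ℂ)) •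
        fun z : Fin k → ℂ => ∏ i, z (r i) := by
    funext z
    have hz : (fun _ : Fin j => z) = fun _ : Fin j => ∑ i : Fin k, z i • (Pi.single i (1:ℂ) : Fin k → ℂ) := by
      funext _
      exact pi_eq_sum_univ' z |>.trans (by
        refine Finset.sum_congr rfl fun i _ => ?_
        congr 1)
    rw [hz]
    have := p.toMultilinearMap.map_sum (fun (_ : Fin j) (i : Fin k) => z i • (Pi.single i (1:ℂ) : Fin k → ℂ))
    simp only [ContinuousMultilinearMap.coe_coe] at this
    rw [this, Finset.sum_apply]
    refine Finset.sum_congr rfl fun r _ => ?_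
    rw [p.map_smul_univ (fun i => z (r i)) (fun i => Pi.single (r i) (1:ℂ))]
    simp [mul_comm]
  rw [h]
  refine Submodule.sum_mem _ fun r _ => Submodule.smul_mem _ _ (Submodule.subset_span ?_)
  refine ⟨fun i => ⟨(Finset.univ.filter fun l => r l = i).card,
    ((Finset.card_le_univ _).trans (by simp)).trans_lt hj⟩, ?_⟩
  funext z
  rw [← Finset.prod_fiberwise' Finset.univ r z]
  simp

lemma taylor_approx {k : ℕ} {R M : ℝ} {g : (Fin k → ℂ) → ℂ}
    (hR : 0 < R) (hg : AnalyticOnNhd ℂ g (ball 0 R))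
    (hM : ∀ z ∈ ball (0 : Fin k → ℂ) R, ‖g z‖ ≤ M) (L : ℕ) :
    ∃ t : (Fin k → Fin L) → ℂ, ∀ z ∈ ball (0 : Fin k → ℂ) (R / 4),
      ‖g z - ∑ γ, t γ * ∏ i, z i ^ (γ i : ℕ)‖ ≤ 2 * M * (1 / 2) ^ L := by
  have hM0 : 0 ≤ M := (norm_nonneg _).trans (hM 0 (by simpa using hR))
  obtain ⟨p, hp⟩ := hg 0 (by simpa using hR)
  have hmem : (∑ j ∈ Finset.range L, fun z : Fin k → ℂ => p j fun _ => z) ∈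
      Submodule.span ℂ (Set.range fun (γ : Fin k → Fin L) (z : Fin k → ℂ) =>
        ∏ i, z i ^ (γ i : ℕ)) :=
    Submodule.sum_mem _ fun j hj => homog_mem_span (Finset.mem_range.1 hj) (p j)
  rw [Submodule.mem_span_range_iff_exists_fun] at hmem
  obtain ⟨t, ht⟩ := hmem
  refine ⟨t, fun z hz => ?_⟩
  have ht' : ∑ γ, t γ * ∏ i, z i ^ (γ i : ℕ) = ∑ j ∈ Finset.range L, p j fun _ => z := by
    have := congrFun ht z
    simpa [Finset.sum_apply] using this
  rw [ht']
  rw [mem_ball_zero_iff] at hz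
  let u : ℂ →L[ℂ] (Fin k → ℂ) := ContinuousLinearMap.toSpanSingleton ℂ z
  have hu : ∀ s, u s = s • z := fun s => by simp [u]
  have hin : ∀ s ∈ closedBall (0:ℂ) (3 : NNReal), u s ∈ ball (0 : Fin k → ℂ) R := by
    intro s hs
    rw [mem_closedBall_zero_iff] at hs
    have hs' : ‖s‖ ≤ 3 := by simpa using hs
    rw [mem_ball_zero_iff, hu, norm_smul]
    nlinarith [norm_nonneg z, norm_nonneg s]
  have hd : DifferentiableOn ℂ (g ∘ u) (closedBall (0:ℂ) (3 : NNReal)) := by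
    intro s hs
    exact ((hg _ (hin s hs)).differentiableAt.comp s u.differentiableAt).differentiableWithinAt
  have h3 : (0 : NNReal) < 3 := by norm_num
  have hc := hd.hasFPowerSeriesOnBall h3
  have hp' : HasFPowerSeriesAt (g ∘ u) (p.compContinuousLinearMap u) 0 :=
    HasFPowerSeriesAt.compContinuousLinearMap (by simpa using hp)
  have heq := hc.hasFPowerSeriesAt.eq_formalMultilinearSeries hp'
  have hterm : ∀ j, (cauchyPowerSeries (g ∘ u) 0 (3:NNReal) j fun _ => (1:ℂ)) = p j fun _ => z := by
    intro j
    rw [heq, FormalMultilinearSeries.compContinuousLinearMap_apply]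
    congr 1
    funext i
    simp [hu]
  have hsum : HasSum (fun j => p j fun _ => z) (g z) := by
    have h1 := hc.hasSum (y := 1) (by
      simp only [Metric.mem_eball, edist_zero_right]
      simp)
    simp only [hterm, zero_add, Function.comp_apply, hu, one_smul] at h1
    exact h1
  have hbound : ∀ j, ‖p j fun _ => z‖ ≤ M * (1 / 3) ^ j := by
    intro j
    rw [← hterm]
    refine ((cauchyPowerSeries (g ∘ u) 0 (3:NNReal) j).le_opNorm _).trans ?_
    simp only [norm_one, Finset.prod_const_one, mul_one]
    refine (norm_cauchyPowerSeries_le _ _ _ _).trans ?_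
    have hInt : ∫ θ : ℝ in (0:ℝ)..2 * Real.pi, ‖(g ∘ u) (circleMap 0 ((3:NNReal):ℝ) θ)‖ ≤ M * (2 * Real.pi) := by
      have := intervalIntegral.norm_integral_le_of_norm_le_const (a := 0) (b := 2 * Real.pi) (C := M)
        (f := fun θ : ℝ => ‖(g ∘ u) (circleMap 0 ((3:NNReal):ℝ) θ)‖) (by
          intro θ _
          rw [norm_norm]
          exact hM _ (hin _ (circleMap_mem_closedBall _ (by simp) _)))
      rw [sub_zero, abs_of_pos Real.two_pi_pos] at this
      exact (Real.le_norm_self _).trans this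
    have hp0 := Real.two_pi_pos
    have : (2 * Real.pi)⁻¹ * ∫ θ : ℝ in (0:ℝ)..2 * Real.pi, ‖(g ∘ u) (circleMap 0 ((3:NNReal):ℝ) θ)‖ ≤ M := by
      rw [inv_mul_le_iff₀ hp0]; linarith
    have h4 : |((3:NNReal):ℝ)|⁻¹ ^ j = (1/3:ℝ) ^ j := by simp
    rw [h4]
    gcongr
  have hs2 : HasSum (fun j => p (j + L) fun _ => z) (g z - ∑ j ∈ Finset.range L, p j fun _ => z) :=
    (hasSum_nat_add_iff' L).2 hsum
  have hgeo : HasSum (fun j : ℕ => M * (1/3:ℝ) ^ (j + L)) (M * (1/3)^L * (1 - 1/3)⁻¹) := by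
    have := (hasSum_geometric_of_lt_one (r := (1/3:ℝ)) (by norm_num) (by norm_num)).mul_left (M * (1/3)^L)
    refine this.congr_fun ?_ 
    intro j; ring
  rw [← hs2.tsum_eq]
  refine (tsum_of_norm_bounded hgeo fun j => hbound _).trans ?_
  have : (1/3:ℝ)^L ≤ (1/2)^L := by gcongr; norm_num
  have h5 : (0:ℝ) ≤ (1/2)^L := by positivity
  nlinarith [mul_le_mul_of_nonneg_left this hM0, mul_nonneg hM0 h5]

lemma exists_dependent {ι κ : Type*} [Fintype ι] [Fintype κ] (h : Fintype.card κ < Fintype.card ι)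
    (t : ι → κ → ℂ) : ∃ c : ι → ℂ, ∑ a, ‖c a‖ = 1 ∧ ∀ γ, ∑ a, c a * t a γ = 0 := by
  have hn : ¬ LinearIndependent ℂ t := by
    intro hl
    have := hl.fintype_card_le_finrank
    rw [Module.finrank_fintype_fun_eq_card] at this
    omega
  rw [Fintype.not_linearIndependent_iff] at hn
  obtain ⟨g, hg, i, hi⟩ := hn
  have hS : 0 < ∑ a, ‖g a‖ :=
    Finset.sum_pos' (fun _ _ => norm_nonneg _) ⟨i, Finset.mem_univ _, norm_pos_iff.2 hi⟩
  refine ⟨fun a => ((∑ a, ‖g a‖ : ℝ) : ℂ)⁻¹ * g a, ?_, fun γ => ?_⟩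
  · simp only [norm_mul, norm_inv, Complex.norm_real, Real.norm_of_nonneg hS.le]
    rw [← Finset.mul_sum, inv_mul_cancel₀ hS.ne']
  · have := congrFun hg γ
    simp only [Finset.sum_apply, Pi.smul_apply, smul_eq_mul, Pi.zero_apply] at this
    simp only [mul_assoc, ← Finset.mul_sum, this, mul_zero]

lemma smallOn_image {k : ℕ} {Φ : (Fin k → ℂ) → (Fin (k + 1) → ℂ)} (hΦ : AnalyticAt ℂ Φ 0) :
    ∃ r > 0, SmallOn (Φ '' ball 0 r) := by
  have hb : ∀ᶠ z in nhds (0 : Fin k → ℂ), ‖Φ z‖ < ‖Φ 0‖ + 1 :=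
    hΦ.continuousAt.norm.eventually_lt continuousAt_const (by simp)
  obtain ⟨R, hR, hball⟩ := Metric.eventually_nhds_iff_ball.1 (hΦ.eventually_analyticAt.and hb)
  set A : ℝ := ‖Φ 0‖ + 1 with hA
  have hA1 : 1 ≤ A := by have := norm_nonneg (Φ 0); linarith
  refine ⟨R / 4, by positivity, fun M => ?_⟩
  have hl2 : 0 < Real.log 2 := Real.log_pos (by norm_num)
  obtain ⟨q, hq⟩ := exists_nat_gt (max 1 (2 * (M + 1 + (k + 1) * Real.log A) / Real.log 2))
  have hq1 : 1 < q := by exact_mod_cast (le_max_left _ _).trans_lt hq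
  have hq2 : 2 * (M + 1 + (k + 1) * Real.log A) < q * Real.log 2 := by
    have := (le_max_right _ _).trans_lt hq
    rwa [div_lt_iff₀ hl2] at this
  have hqk : 1 ≤ q ^ k := Nat.one_le_pow _ _ (by omega)
  obtain ⟨d, hd⟩ : ∃ d, d + 1 = 2 * q ^ k := ⟨2 * q ^ k - 1, by omega⟩
  have hd1 : 1 ≤ d := by omega
  let L := q ^ (k + 1)
  have hcard : Fintype.card (Fin k → Fin L) < Fintype.card (Fin (k + 1) → Fin (d + 1)) := by
    simp only [Fintype.card_fun, Fintype.card_fin, L, hd]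
    rw [mul_pow, ← pow_mul, ← pow_mul, mul_comm (k+1) k]
    have h1 : 0 < q ^ (k * (k+1)) := by positivity
    have h2 : 1 < 2 ^ (k + 1) := Nat.one_lt_two_pow (by omega)
    nlinarith
  have hΦi : ∀ z ∈ ball (0 : Fin k → ℂ) R, ∀ i, AnalyticAt ℂ (fun z => Φ z i) z := by
    intro z hz i
    exact (analyticAt_pi_iff.1 (hball z hz).1) i
  have hM' : ∀ α : Fin (k+1) → Fin (d+1), ∀ z ∈ ball (0 : Fin k → ℂ) R,
      ‖∏ i, Φ z i ^ (α i : ℕ)‖ ≤ A ^ ((k + 1) * d) := by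
    intro α z hz
    rw [norm_prod]
    calc ∏ i, ‖Φ z i ^ (α i : ℕ)‖ ≤ ∏ i : Fin (k+1), A ^ d := by
          refine Finset.prod_le_prod (fun _ _ => norm_nonneg _) fun i _ => ?_
          rw [norm_pow]
          calc ‖Φ z i‖ ^ (α i : ℕ) ≤ A ^ (α i : ℕ) :=
                pow_le_pow_left₀ (norm_nonneg _) ((norm_le_pi_norm _ i).trans (hball z hz).2.le) _
            _ ≤ A ^ d := pow_le_pow_right₀ hA1 (by omega)
      _ = _ := by simp [← pow_mul, mul_comm]
  choose t ht using fun α : Fin (k+1) → Fin (d+1) =>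
    taylor_approx (g := fun z => ∏ i, Φ z i ^ (α i : ℕ)) hR
      (fun z hz => Finset.analyticAt_fun_prod _ fun i _ => (hΦi z hz i).pow _) (hM' α) L
  obtain ⟨c, hc1, hc2⟩ := exists_dependent hcard t
  refine ⟨d, hd1, c, hc1, ?_⟩
  rintro _ ⟨z, hz, rfl⟩
  have key : pev c (Φ z) = ∑ α, c α * (∏ i, Φ z i ^ (α i : ℕ) - ∑ γ, t α γ * ∏ i, z i ^ (γ i : ℕ)) := by
    simp only [mul_sub, Finset.sum_sub_distrib]
    have : ∑ α, c α * ∑ γ, t α γ * ∏ i, z i ^ (γ i : ℕ) = 0 := by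
      simp only [Finset.mul_sum]
      rw [Finset.sum_comm]
      refine Finset.sum_eq_zero fun γ _ => ?_
      simp only [← mul_assoc]
      rw [← Finset.sum_mul, hc2, zero_mul]
    rw [this, sub_zero]; rfl
  have h1 : ‖pev c (Φ z)‖ ≤ 2 * A ^ ((k + 1) * d) * (1 / 2) ^ L := by
    rw [key]
    refine (norm_sum_le _ _).trans ?_
    calc _ ≤ ∑ α, ‖c α‖ * (2 * A ^ ((k + 1) * d) * (1 / 2) ^ L) := by
          refine Finset.sum_le_sum fun α _ => ?_
          rw [norm_mul]
          exact mul_le_mul_of_nonneg_left (ht α z hz) (norm_nonneg _)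
      _ = _ := by rw [← Finset.sum_mul, hc1, one_mul]
  refine h1.trans ?_
  have hA0 : 0 < A := by linarith
  have e1 : A ^ ((k + 1) * d) = Real.exp (Real.log A * ((k + 1) * d)) := by
    rw [Real.exp_mul, Real.exp_log hA0, ← Real.rpow_natCast]; push_cast; rfl
  have e2 : (1 / 2 : ℝ) ^ L = Real.exp (-(Real.log 2 * L)) := by
    rw [Real.exp_neg, Real.exp_mul, Real.exp_log two_pos, Real.rpow_natCast]; simp
  have hdR : (1:ℝ) ≤ d := by exact_mod_cast hd1
  have e3 : (2:ℝ) ≤ Real.exp d := by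
    have := Real.add_one_le_exp (d:ℝ); linarith
  have hL : (q:ℝ) * d ≤ 2 * L := by
    have : q * d ≤ 2 * L := by
      simp only [L, pow_succ]
      have : d ≤ 2 * q ^ k := by omega
      nlinarith
    exact_mod_cast this
  calc 2 * A ^ ((k + 1) * d) * (1 / 2) ^ L
      ≤ Real.exp d * A ^ ((k + 1) * d) * (1 / 2) ^ L := by gcongr
    _ = Real.exp (d + Real.log A * ((k + 1) * d) + -(Real.log 2 * L)) := by
        rw [e1, e2, Real.exp_add, Real.exp_add]
    _ ≤ _ := by
        apply Real.exp_le_exp.2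
        nlinarith [mul_le_mul_of_nonneg_left hL hl2.le, mul_le_mul_of_nonneg_right hq2.le (by linarith : (0:ℝ) ≤ d)]

lemma smallOn_empty {n : ℕ} : SmallOn (∅ : Set (Fin n → ℂ)) := by
  classical
  intro M
  refine ⟨1, le_rfl, Pi.single 0 1, ?_, by simp⟩
  rw [Finset.sum_eq_single 0]
  · simp
  · intro b _ hb; simp [hb]
  · simp

lemma smallOn_hypersurface {k : ℕ} {g : (Fin (k + 1) → ℂ) → ℂ} {p : Fin (k + 1) → ℂ}
    (hg : AnalyticAt ℂ g p) (hgp : g p = 0) (j : Fin (k + 1))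
    (hj : fderiv ℂ g p (Pi.single j 1) ≠ 0) :
    ∃ U ∈ nhds p, SmallOn (U ∩ {z | g z = 0}) := by
  classical
  let F : (Fin (k + 1) → ℂ) → (Fin (k + 1) → ℂ) := fun z i => if i = j then g z else z i - p i
  have hF : AnalyticAt ℂ F p := by
    rw [analyticAt_pi_iff]
    intro i
    by_cases hi : i = j
    · simpa [F, hi] using hg
    · simp only [F, hi, if_false]
      exact ((ContinuousLinearMap.proj (R := ℂ) (φ := fun _ : Fin (k+1) => ℂ) i).analyticAt p).sub
        analyticAt_const
  let T : (Fin (k + 1) → ℂ) →L[ℂ] (Fin (k + 1) → ℂ) :=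
    ContinuousLinearMap.pi fun i => if i = j then fderiv ℂ g p else ContinuousLinearMap.proj i
  have hT : HasFDerivAt F T p := by
    rw [hasFDerivAt_pi]
    intro i
    by_cases hi : i = j
    · simpa [F, hi] using hg.differentiableAt.hasFDerivAt
    · simp only [F, hi, if_false]
      exact (ContinuousLinearMap.proj (R := ℂ) (φ := fun _ : Fin (k+1) => ℂ) i).hasFDerivAt.sub_const _
  have hinj : Function.Injective T.toLinearMap := by
    rw [← LinearMap.ker_eq_bot, LinearMap.ker_eq_bot']
    intro v hv
    have hvi : ∀ i, T v i = 0 := fun i => congrFun hv i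
    have h1 : ∀ i, i ≠ j → v i = 0 := fun i hi => by simpa [T, hi] using hvi i
    have h2 : fderiv ℂ g p v = 0 := by simpa [T] using hvi j
    have h3 : v = v j • (Pi.single j 1 : Fin (k+1) → ℂ) := by
      funext i
      by_cases hi : i = j
      · subst hi; simp
      · simp [h1 i hi, hi]
    rw [h3, map_smul, smul_eq_mul] at h2
    have h4 : v j = 0 := (mul_eq_zero.1 h2).resolve_right hj
    rw [h3, h4, zero_smul]
  let e : (Fin (k + 1) → ℂ) ≃L[ℂ] (Fin (k + 1) → ℂ) :=
    (LinearEquiv.ofInjectiveEndo T.toLinearMap hinj).toContinuousLinearEquiv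
  have he : (e : (Fin (k + 1) → ℂ) →L[ℂ] (Fin (k + 1) → ℂ)) = T := by
    ext v i; rfl
  have hs : HasStrictFDerivAt F (e : (Fin (k + 1) → ℂ) →L[ℂ] (Fin (k + 1) → ℂ)) p := by
    rw [he, ← hT.fderiv]; exact hF.hasStrictFDerivAt
  let h := hs.toOpenPartialHomeomorph F
  have hps : p ∈ h.source := hs.mem_toOpenPartialHomeomorph_source
  have hFp : F p = 0 := by
    funext i
    by_cases hi : i = j <;> simp [F, hi, hgp]
  have hsymm : AnalyticAt ℂ h.symm (F p) :=
    h.analyticAt_symm' (i := e) hps hF (by rw [he]; exact hT.fderiv)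
  rw [hFp] at hsymm
  let ins : (Fin k → ℂ) → (Fin (k + 1) → ℂ) := fun w => j.insertNth 0 w
  have hins0 : ins 0 = 0 := by
    funext i
    refine Fin.succAboveCases j ?_ (fun i => ?_) i <;> simp [ins]
  have hins : AnalyticAt ℂ ins 0 := by
    rw [analyticAt_pi_iff]
    intro i
    refine Fin.succAboveCases j ?_ (fun i => ?_) i
    · simpa [ins] using analyticAt_const
    · simp only [ins, Fin.insertNth_apply_succAbove]
      exact (ContinuousLinearMap.proj (R := ℂ) (φ := fun _ : Fin k => ℂ) i).analyticAt _
  have hΦ : AnalyticAt ℂ (fun w => h.symm (ins w)) 0 :=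
    AnalyticAt.comp' (by rwa [hins0]) hins
  obtain ⟨r, hr, hsm⟩ := smallOn_image hΦ
  refine ⟨h.source ∩ ball p r, Filter.inter_mem (h.open_source.mem_nhds hps) (ball_mem_nhds _ hr), ?_⟩
  refine SmallOn.mono hsm ?_
  rintro z ⟨⟨hz1, hz2⟩, hz3⟩
  refine ⟨fun i => z (j.succAbove i) - p (j.succAbove i), ?_, ?_⟩
  · rw [mem_ball, dist_pi_lt_iff hr] at hz2
    rw [mem_ball_zero_iff, pi_norm_lt_iff hr]
    intro i
    rw [← dist_eq_norm]
    exact hz2 _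
  · have : ins (fun i => z (j.succAbove i) - p (j.succAbove i)) = F z := by
      have hz3' : g z = 0 := hz3
      funext i
      refine Fin.succAboveCases j ?_ (fun i => ?_) i
      · simp [ins, F, hz3']
      · simp [ins, F, Fin.succAbove_ne]
    simp only [this]
    exact h.left_inv hz1

/-- Iterated coordinate derivatives. -/
def ipd {n : ℕ} (f : (Fin n → ℂ) → ℂ) : List (Fin n) → (Fin n → ℂ) → ℂ
  | [] => f
  | j :: l => fun z => fderiv ℂ (ipd f l) z (Pi.single j 1)

lemma ipd_analytic {n : ℕ} {D : Set (Fin n → ℂ)} {f : (Fin n → ℂ) → ℂ}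
    (hf : AnalyticOnNhd ℂ f D) (l : List (Fin n)) : AnalyticOnNhd ℂ (ipd f l) D := by
  induction l with
  | nil => exact hf
  | cons j l ih =>
    intro z hz
    exact ((ContinuousLinearMap.apply ℂ ℂ (Pi.single j (1:ℂ) : Fin n → ℂ)).analyticAt _).comp' (ih z hz).fderiv

lemma iteratedFDeriv_eq_ipd {n : ℕ} {D : Set (Fin n → ℂ)} (hD : IsOpen D) {f : (Fin n → ℂ) → ℂ}
    (hf : AnalyticOnNhd ℂ f D) (m : ℕ) : ∀ (v : Fin m → Fin n), ∀ z ∈ D,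
      iteratedFDeriv ℂ m f z (fun i => Pi.single (v i) 1) = ipd f (List.ofFn v) z := by
  induction m with
  | zero => intro v z _; simp [ipd]
  | succ m ih =>
    intro v z hz
    rw [iteratedFDeriv_succ_apply_left, List.ofFn_succ]
    have hd : DifferentiableAt ℂ (iteratedFDeriv ℂ m f) z :=
      (hf.iteratedFDeriv m z hz).differentiableAt
    have h1 : fderiv ℂ (ipd f (List.ofFn fun i => v i.succ)) z =
        fderiv ℂ (fun z => iteratedFDeriv ℂ m f z (fun i : Fin m => Pi.single (v i.succ) (1:ℂ))) z := by
      apply Filter.EventuallyEq.fderiv_eq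
      filter_upwards [hD.mem_nhds hz] with y hy
      exact (ih (fun i => v i.succ) y hy).symm
    simp only [ipd]
    rw [h1]
    have h2 := ((ContinuousMultilinearMap.apply ℂ (fun _ : Fin m => Fin n → ℂ) ℂ
      (fun i : Fin m => Pi.single (v i.succ) (1:ℂ))).hasFDerivAt.comp z hd.hasFDerivAt).fderiv
    simp only [Function.comp_def, ContinuousMultilinearMap.apply_apply] at h2
    rw [h2]
    rfl

lemma eventually_zero_of_ipd {n : ℕ} {D : Set (Fin n → ℂ)} (hD : IsOpen D) {f : (Fin n → ℂ) → ℂ}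
    (hf : AnalyticOnNhd ℂ f D) {p : Fin n → ℂ} (hp : p ∈ D) (h : ∀ l, ipd f l p = 0) :
    f =ᶠ[nhds p] 0 := by
  obtain ⟨q, r, hq⟩ := hf p hp
  have hz : ∀ m, iteratedFDeriv ℂ m f p = 0 := by
    intro m
    apply ContinuousMultilinearMap.toMultilinearMap_injective
    refine Module.Basis.ext_multilinear (fun _ => Pi.basisFun ℂ (Fin n)) fun v => ?_
    have := iteratedFDeriv_eq_ipd hD hf m v p hp
    simpa [h] using this
  have hmem : (fun y => p + y) '' Metric.eball 0 r ∈ nhds p := by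
    have := Metric.eball_mem_nhds p hq.r_pos
    filter_upwards [this] with y hy
    refine ⟨y - p, ?_, by simp⟩
    simpa [edist_eq_enorm_sub] using hy
  filter_upwards [hmem] with y hy
  obtain ⟨w, hw, rfl⟩ := hy
  have := hq.hasSum_iteratedFDeriv hw
  simp only [hz] at this
  exact this.unique (by simpa using hasSum_zero)

theorem zero_set_pluripolar {n : ℕ} {D : Set (Fin n → ℂ)} (hD : IsOpen D) (hc : IsPreconnected D)
    {f : (Fin n → ℂ) → ℂ} (hf : AnalyticOnNhd ℂ f D) (hne : ∃ z ∈ D, f z ≠ 0) :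
    Pluripolar {z | z ∈ D ∧ f z = 0} := by
  have hloc : ∀ l : List (Fin n), ∀ p, p ∈ D → ipd f l p = 0 → (∃ j, ipd f (j :: l) p ≠ 0) →
      ∃ U ∈ nhds p, SmallOn (U ∩ {z | ipd f l z = 0}) := by
    rintro l p hp h0 ⟨j, hj⟩
    cases n with
    | zero => exact j.elim0
    | succ k => exact smallOn_hypersurface (ipd_analytic hf l p hp) h0 j hj
  let S : List (Fin n) → Set (Fin n → ℂ) := fun l =>
    {p | p ∈ D ∧ ipd f l p = 0 ∧ ∃ j, ipd f (j :: l) p ≠ 0}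
  have hex : ∀ l p, ∃ U : Set (Fin n → ℂ), SmallOn U ∧ (p ∈ S l → U ∈ nhdsWithin p (S l)) := by
    intro l p
    by_cases hp : p ∈ S l
    · obtain ⟨U, hU, hs⟩ := hloc l p hp.1 hp.2.1 hp.2.2
      refine ⟨_, hs, fun _ => ?_⟩
      filter_upwards [mem_nhdsWithin_of_mem_nhds hU, self_mem_nhdsWithin] with z h1 h2
      exact ⟨h1, h2.2.1⟩
    · exact ⟨∅, smallOn_empty, fun h => absurd h hp⟩
  choose U hU1 hU2 using hex
  choose t ht1 ht2 ht3 using fun l =>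
    TopologicalSpace.countable_cover_nhdsWithin (f := U l) (s := S l) (hU2 l)
  let 𝓔 : Set (Set (Fin n → ℂ)) := insert ∅ (⋃ l, U l '' t l)
  have hcount : 𝓔.Countable := (countable_iUnion fun l => (ht2 l).image _).insert _
  obtain ⟨E, hE⟩ := hcount.exists_eq_range ⟨∅, mem_insert _ _⟩
  have hsmall : ∀ j, SmallOn (E j) := by
    intro j
    have : E j ∈ 𝓔 := hE ▸ mem_range_self j
    rcases this with h | h
    · rw [h]; exact smallOn_empty
    · obtain ⟨l, x, _, hx⟩ := mem_iUnion.1 h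
      rw [← hx]; exact hU1 l x
  obtain ⟨u, hu1, hu2, hu3⟩ := pluripolar_of_smallOn E hsmall
  refine ⟨u, hu1, hu2, ?_⟩
  rintro p ⟨hp, hfp⟩
  apply hu3
  have hS : ∃ l, p ∈ S l := by
    by_contra hno
    have hall : ∀ l, ipd f l p = 0 := by
      intro l
      induction l with
      | nil => exact hfp
      | cons j l ih =>
        by_contra hjl
        exact hno ⟨l, hp, ih, j, hjl⟩
    obtain ⟨z, hz, hfz⟩ := hne
    exact hfz (hf.eqOn_zero_of_preconnected_of_eventuallyEq_zero hc hp
      (eventually_zero_of_ipd hD hf hp hall) hz)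
  obtain ⟨l, hl⟩ := hS
  obtain ⟨x, hx, hpx⟩ := mem_iUnion₂.1 (ht3 l hl)
  have : U l x ∈ 𝓔 := mem_insert_of_mem _ (mem_iUnion.2 ⟨l, x, hx, rfl⟩)
  rw [hE] at this
  obtain ⟨i, hi⟩ := this
  exact mem_iUnion.2 ⟨i, hi ▸ hpx⟩

lemma analytic_of_rado {n : ℕ} {D : Set (Fin n → ℂ)} (hD : IsOpen D) {f : (Fin n → ℂ) → ℂ}
    (hf : ContinuousOn f D) (hfd : ∀ z ∈ D, f z ≠ 0 → DifferentiableAt ℂ f z) :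
    AnalyticOnNhd ℂ f D := by
  intro c hc
  obtain ⟨R, hR, hRD⟩ := Metric.nhds_basis_closedBall.mem_iff.1 (hD.mem_nhds hc)
  refine osgood hR (hf.mono hRD) ?_
  intro z hz i
  have hmem : ∀ t : ℂ, t ∈ closedBall (0:ℂ) R → Function.update z i (c i + t) ∈ closedBall c R := by
    intro t ht
    rw [mem_closedBall, dist_pi_le_iff hR.le] at hz ⊢
    intro j
    by_cases h : j = i
    · subst h
      simpa [dist_eq_norm] using ht
    · simpa [h] using hz j
  have hdu : ∀ t : ℂ, DifferentiableAt ℂ (fun t => Function.update z i (c i + t)) t := by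
    intro t
    rw [differentiableAt_pi]
    intro j
    by_cases h : j = i
    · subst h
      simp only [Function.update_self]
      fun_prop
    · simp only [Function.update_of_ne h]
      fun_prop
  have h1 : DifferentiableOn ℂ (fun t => f (Function.update z i (c i + t))) (ball 0 R) := by
    refine rado hR ?_ ?_
    · refine (hf.mono hRD).comp ?_ hmem
      exact fun t _ => (hdu t).continuousAt.continuousWithinAt
    · intro t ht h0
      exact DifferentiableAt.comp t (hfd _ (hRD (hmem t (ball_subset_closedBall ht))) h0) (hdu t)
  have h2 : (fun t => f (Function.update z i t)) =
      (fun t => f (Function.update z i (c i + t))) ∘ (fun t => t - c i) := by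
    ext t; simp
  rw [h2]
  refine h1.comp (by fun_prop) ?_
  intro t ht
  simpa [dist_eq_norm] using ht

lemma coeffs_of_full_root {m : ℕ} (hm : 0 < m) (a : Fin m → ℂ) (c : ℂ)
    (h : ∀ w : ℂ, w ^ m + ∑ i : Fin m, a i * w ^ (m - ((i : ℕ) + 1)) = (w - c) ^ m) (i : Fin m) :
    a i = (m.choose ((i : ℕ) + 1) : ℂ) * (a ⟨0, hm⟩ / (m : ℂ)) ^ ((i : ℕ) + 1) := by
  have hp : (X ^ m + ∑ i : Fin m, C (a i) * X ^ (m - ((i : ℕ) + 1)) : ℂ[X]) = (X + C (-c)) ^ m := by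
    refine Polynomial.funext fun w => ?_
    simpa [Polynomial.eval_finsetSum, ← sub_eq_add_neg] using h w
  have hco : ∀ i : Fin m, a i = (m.choose ((i : ℕ) + 1) : ℂ) * (-c) ^ ((i : ℕ) + 1) := by
    intro i
    have h1 := congrArg (fun q => Polynomial.coeff q (m - ((i : ℕ) + 1))) hp
    simp only [coeff_add, Polynomial.finsetSum_coeff, coeff_C_mul, coeff_X_pow,
      Polynomial.coeff_X_add_C_pow] at h1
    have hi := i.isLt
    rw [if_neg (by omega), Finset.sum_eq_single i] at h1
    · have h2 : m - (m - ((i : ℕ) + 1)) = (i : ℕ) + 1 := by omega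
      rw [h2, Nat.choose_symm (by omega)] at h1
      simp at h1
      rw [h1]; ring
    · intro j _ hj
      have := j.isLt
      have : (j : ℕ) ≠ i := fun h => hj (Fin.ext h)
      rw [if_neg (by omega)]; simp
    · simp
  have h0 := hco ⟨0, hm⟩
  have hm' : (m : ℂ) ≠ 0 := by exact_mod_cast hm.ne'
  have : a ⟨0, hm⟩ / (m : ℂ) = -c := by
    rw [h0]; simp; field_simp
  rw [this]; exact hco i

lemma full_root_of_coeffs {m : ℕ} (a : Fin m → ℂ) (s : ℂ)
    (h : ∀ i : Fin m, a i = (m.choose ((i : ℕ) + 1) : ℂ) * s ^ ((i : ℕ) + 1)) (w : ℂ) :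
    w ^ m + ∑ i : Fin m, a i * w ^ (m - ((i : ℕ) + 1)) = (w + s) ^ m := by
  rw [add_comm w s, add_pow, Finset.sum_range_succ', ← Fin.sum_univ_eq_sum_range
    (fun k => s ^ (k + 1) * w ^ (m - (k + 1)) * (m.choose (k + 1) : ℂ)), add_comm]
  congr 1
  · refine Finset.sum_congr rfl fun i _ => ?_
    rw [h i]; ring
  · simp

theorem P_eq_pow_of_nonpluripolar_full_multiplicity_set
    {n m : ℕ} (hm : 0 < m) (D : Set (Fin n → ℂ))
    (hDopen : IsOpen D) (hDconn : IsConnected D)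
    (a : Fin m → (Fin n → ℂ) → ℂ) (ha : ∀ i, ContinuousOn (a i) D)
    (B : Set (Fin n → ℂ))
    (hB : B = {z | z ∈ D ∧ ∃ c : ℂ, ∀ w : ℂ,
      w ^ m + ∑ i : Fin m, a i z * w ^ (m - ((i : ℕ) + 1)) = (w - c) ^ m})
    (hhol : ∀ i, DifferentiableOn ℂ (a i) (D \ B))
    (hBnp : ¬ Pluripolar B) :
    (∀ z ∈ D, ∀ w : ℂ,
        w ^ m + ∑ i : Fin m, a i z * w ^ (m - ((i : ℕ) + 1)) =
          (w + a ⟨0, hm⟩ z / (m : ℂ)) ^ m) ∧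
      B = D ∧
      ∀ z ∈ D, ∀ i : Fin m,
        a i z = (m.choose ((i : ℕ) + 1) : ℂ) * (a ⟨0, hm⟩ z / (m : ℂ)) ^ ((i : ℕ) + 1) := by
  have hBmem : ∀ z, z ∈ B ↔ z ∈ D ∧ ∀ i : Fin m,
      a i z = (m.choose ((i : ℕ) + 1) : ℂ) * (a ⟨0, hm⟩ z / (m : ℂ)) ^ ((i : ℕ) + 1) := by
    intro z
    rw [hB]
    constructor
    · rintro ⟨hz, c, hc⟩
      exact ⟨hz, coeffs_of_full_root hm (fun i => a i z) c hc⟩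
    · rintro ⟨hz, h⟩
      refine ⟨hz, -(a ⟨0, hm⟩ z / (m : ℂ)), fun w => ?_⟩
      rw [sub_neg_eq_add]
      exact full_root_of_coeffs (fun i => a i z) _ h w
  let b : Fin m → (Fin n → ℂ) → ℂ := fun i z =>
    a i z - (m.choose ((i : ℕ) + 1) : ℂ) * (a ⟨0, hm⟩ z / (m : ℂ)) ^ ((i : ℕ) + 1)
  have hbc : ∀ i, ContinuousOn (b i) D := fun i =>
    (ha i).sub (continuousOn_const.mul (((ha ⟨0, hm⟩).div_const _).pow _))
  have hbd : ∀ i, DifferentiableOn ℂ (b i) (D \ B) := fun i =>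
    (hhol i).sub (by
      have := ((hhol ⟨0, hm⟩).mul_const ((m : ℂ)⁻¹)).pow ((i : ℕ) + 1)
      simp only [div_eq_mul_inv]
      exact this.const_mul _)
  have hB2 : ∀ z ∈ B, ∀ i, b i z = 0 := fun z hz i => sub_eq_zero.2 (((hBmem z).1 hz).2 i)
  have hopen : IsOpen (D \ B) := by
    rw [isOpen_iff_mem_nhds]
    rintro z ⟨hzD, hzB⟩
    have : ∃ i, b i z ≠ 0 := by
      by_contra hcon
      push Not at hcon
      exact hzB ((hBmem z).2 ⟨hzD, fun i => sub_eq_zero.1 (hcon i)⟩)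
    obtain ⟨i, hi⟩ := this
    have h1 := ((hbc i).continuousAt (hDopen.mem_nhds hzD)).eventually_ne hi
    filter_upwards [h1, hDopen.mem_nhds hzD] with y hy hyD
    exact ⟨hyD, fun hyB => hy (hB2 y hyB i)⟩
  have key : ∀ z ∈ D, ∀ i : Fin m, b i z = 0 := by
    by_contra hcon
    push Not at hcon
    obtain ⟨z, hz, i, hi⟩ := hcon
    have han : AnalyticOnNhd ℂ (b i) D := by
      refine analytic_of_rado hDopen (hbc i) ?_
      intro y hy hy0
      refine (hbd i).differentiableAt (hopen.mem_nhds ⟨hy, fun hyB => hy0 (hB2 y hyB i)⟩)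
    obtain ⟨u, hu, hu1, hu2⟩ := zero_set_pluripolar hDopen hDconn.isPreconnected han ⟨z, hz, hi⟩
    exact hBnp ⟨u, hu, hu1, fun y hy => hu2 y ⟨((hBmem y).1 hy).1, hB2 y hy i⟩⟩
  have key' : ∀ z ∈ D, ∀ i : Fin m,
      a i z = (m.choose ((i : ℕ) + 1) : ℂ) * (a ⟨0, hm⟩ z / (m : ℂ)) ^ ((i : ℕ) + 1) :=
    fun z hz i => sub_eq_zero.1 (key z hz i)
  refine ⟨fun z hz w => full_root_of_coeffs (fun i => a i z) _ (key' z hz) w, ?_, key'⟩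
  ext z
  exact ⟨fun h => ((hBmem z).1 h).1, fun h => (hBmem z).2 ⟨h, key' z h⟩⟩
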